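/- Given M > 0, the following holds provided α > 0 is small enough. Let X : [0,1) → B_α be an admissible curve with return times n_k. For each n ≥ 0 and k ≥ 0, if ω is an element of 𝒫_n on which n_k ≡ n, then the Lebesgue measure of {θ ∈ ω : n_{k+1}(θ) − n_k(θ) ≤ N(α) + M} is at most (2/3)·|ω|. -/

import Mathlib

open Set MeasureTheory Filter
open scoped ENNReal

noncomputable section

/-- The quadratic map `f(x) = a - x²`. -/
def qm (a : ℝ) : ℝ → ℝ := fun x => a - x ^ 2

/-- The critical point `0` of `qm a` is strictly pre-periodic: its forward orbit never
returns to `0` and is eventually periodic. -/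
def StrictlyPreperiodic (a : ℝ) : Prop :=
  (∀ i : ℕ, 1 ≤ i → (qm a)^[i] 0 ≠ 0) ∧
    ∃ m p : ℕ, 1 ≤ m ∧ 1 ≤ p ∧ (qm a)^[m + p] 0 = (qm a)^[m] 0

/-- A lift of the Viana skew product `F(θ, x) = (dθ, f(x) + αφ(θ))` to `ℝ × ℝ`;
for `φ` of period `1` this is a lift of the corresponding map of `(ℝ/ℤ) × ℝ`. -/
def Viana (a : ℝ) (d : ℕ) (φ : ℝ → ℝ) (α : ℝ) : ℝ × ℝ → ℝ × ℝ :=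
  fun p => ((d : ℝ) * p.1, qm a p.2 + α * φ p.1)

/-- The fibre maps `f_n`, defined by `F^n(θ, x) = (d^n θ, f_n(θ, x))`. -/
def fn (a : ℝ) (d : ℕ) (φ : ℝ → ℝ) (α : ℝ) (n : ℕ) (θ x : ℝ) : ℝ :=
  ((Viana a d φ α)^[n] (θ, x)).2

/-- Endpoints of the shadowing intervals: `IEnd a α n` gives the endpoints of `I_{n+1}`, where
`I₁ = [c₁ - 2α, c₁ + 2α]` and `I_{n+1}` is the closed interval containing `f(I_n)` both of whose
complementary components in `I_{n+1}` have length `α`. -/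
def IEnd (a α : ℝ) : ℕ → ℝ × ℝ
  | 0 => (qm a 0 - 2 * α, qm a 0 + 2 * α)
  | n + 1 =>
      (sInf (qm a '' Set.Icc (IEnd a α n).1 (IEnd a α n).2) - α,
        sSup (qm a '' Set.Icc (IEnd a α n).1 (IEnd a α n).2) + α)

/-- The shadowing interval `I_n`, for `n ≥ 1`. -/
def Iseq (a α : ℝ) (n : ℕ) : Set ℝ := Set.Icc (IEnd a α (n - 1)).1 (IEnd a α (n - 1)).2

/-- The length `|I_{n+1}|` of the shadowing interval `I_{n+1}`. -/
def len (a α : ℝ) (n : ℕ) : ℝ := (IEnd a α n).2 - (IEnd a α n).1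

/-- `N(α)`: the maximal integer `N` such that `|I_n| < ξ₀` for all `1 ≤ n ≤ N` and
`∑_{n=1}^{N} |I_n| ≤ ξ₀`. -/
def Nal (a ξ₀ α : ℝ) : ℕ :=
  sSup {N : ℕ | (∀ n : ℕ, 1 ≤ n → n ≤ N → len a α (n - 1) < ξ₀) ∧
    ∑ n ∈ Finset.range N, len a α n ≤ ξ₀}

/-- A curve `X : [0,1) → B = [-β, β]` is admissible if it is the image of a horizontal curve
under `F^n` for some `n ≥ n₀ + 1`: there are `ω = [j/dⁿ, (j+1)/dⁿ) ∈ 𝒫_n` and `x₀ ∈ B` with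
`X(dⁿθ mod 1) = f_n(θ, x₀)` for all `θ ∈ ω`; equivalently `X(t) = f_n((t+j)/dⁿ, x₀)` on `[0,1)`. -/
def Admissible (a : ℝ) (d : ℕ) (φ : ℝ → ℝ) (α β : ℝ) (n₀ : ℕ) (X : ℝ → ℝ) : Prop :=
  ∃ n : ℕ, n₀ + 1 ≤ n ∧ ∃ j : ℕ, j < d ^ n ∧ ∃ x₀ ∈ Set.Icc (-β) β,
    ∀ θ ∈ Set.Ico (0 : ℝ) 1, X θ = fn a d φ α n ((θ + j) / (d : ℝ) ^ n) x₀

/-- `IsRet … X θ n` holds iff `n = 0` or `n` is a return time of `θ` for the curve `X`: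
there is `θ'` in the same element of the partition `𝒫_n` of `[0,1)` as `θ` with
`|f_n(θ', X(θ'))| ≤ α^{0.6}`. -/
def IsRet (a : ℝ) (d : ℕ) (φ : ℝ → ℝ) (α : ℝ) (X : ℝ → ℝ) (θ : ℝ) (n : ℕ) : Prop :=
  n = 0 ∨ 1 ≤ n ∧ ∃ θ' ∈ Set.Ico (0 : ℝ) 1,
    ⌊θ' * (d : ℝ) ^ n⌋ = ⌊θ * (d : ℝ) ^ n⌋ ∧ |fn a d φ α n θ' (X θ')| ≤ α ^ (0.6 : ℝ)

/-- `n_k(θ)` is defined, i.e. `{0} ∪ {return times of θ}` has more than `k` elements. -/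
def NkDef (a : ℝ) (d : ℕ) (φ : ℝ → ℝ) (α : ℝ) (X : ℝ → ℝ) (θ : ℝ) (k : ℕ) : Prop :=
  {n : ℕ | IsRet a d φ α X θ n}.Infinite ∨ k < {n : ℕ | IsRet a d φ α X θ n}.ncard

/-- `n_k(θ)`: the `k`-th smallest element of `{0} ∪ {return times of θ}` (so `n₀(θ) = 0`). -/
def nk (a : ℝ) (d : ℕ) (φ : ℝ → ℝ) (α : ℝ) (X : ℝ → ℝ) (θ : ℝ) (k : ℕ) : ℕ :=
  Nat.nth (IsRet a d φ α X θ) k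

open scoped Topology

theorem viana_iterate_fst (a : ℝ) (d : ℕ) (φ : ℝ → ℝ) (α : ℝ) (n : ℕ) (p : ℝ × ℝ) :
    ((Viana a d φ α)^[n] p).1 = (d : ℝ) ^ n * p.1 := by
  induction n with
  | zero => simp
  | succ n ih => rw [Function.iterate_succ_apply', Viana, ih]; ring

theorem fn_zero (a : ℝ) (d : ℕ) (φ : ℝ → ℝ) (α θ x : ℝ) : fn a d φ α 0 θ x = x := rfl

theorem fn_add (a : ℝ) (d : ℕ) (φ : ℝ → ℝ) (α : ℝ) (m n : ℕ) (θ x : ℝ) :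
    fn a d φ α (n + m) θ x = fn a d φ α n ((d : ℝ) ^ m * θ) (fn a d φ α m θ x) := by
  unfold fn
  rw [Function.iterate_add_apply]
  congr 2
  exact Prod.ext (viana_iterate_fst ..) rfl

theorem fn_succ (a : ℝ) (d : ℕ) (φ : ℝ → ℝ) (α : ℝ) (n : ℕ) (θ x : ℝ) :
    fn a d φ α (n + 1) θ x = qm a (fn a d φ α n θ x) + α * φ ((d : ℝ) ^ n * θ) := by
  unfold fn
  rw [Function.iterate_succ_apply']
  simp [Viana, viana_iterate_fst]

theorem fn_succ' (a : ℝ) (d : ℕ) (φ : ℝ → ℝ) (α : ℝ) (n : ℕ) (θ x : ℝ) :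
    fn a d φ α (n + 1) θ x = fn a d φ α n (d * θ) (qm a x + α * φ θ) := rfl

theorem Function.Periodic.add_natCast {φ : ℝ → ℝ} (hφ : Function.Periodic φ 1) (x : ℝ) (k : ℕ) :
    φ (x + k) = φ x := by
  simpa using hφ.nat_mul k x

theorem fn_add_natCast (a : ℝ) (d : ℕ) {φ : ℝ → ℝ} (hφ : Function.Periodic φ 1) (α : ℝ)
    (n j : ℕ) (θ x : ℝ) : fn a d φ α n (θ + j) x = fn a d φ α n θ x := by
  induction n with
  | zero => rfl
  | succ n ih =>
    rw [fn_succ, fn_succ, ih]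
    have := hφ.add_natCast ((d : ℝ) ^ n * θ) (d ^ n * j)
    push_cast at this
    rw [mul_add, this]

/-- The interval `[-β, β]` is mapped into itself by every `α`-perturbation of `qm a`. -/
def Traps (a β α : ℝ) : Prop :=
  ∀ x ∈ Icc (-β) β, ∀ s : ℝ, |s| ≤ 1 → qm a x + α * s ∈ Icc (-β) β

theorem continuous_qm (a : ℝ) : Continuous (qm a) := by unfold qm; fun_prop

theorem eventually_traps {a β : ℝ} (hβ : 0 ≤ β)
    (hβmap : ∀ x ∈ Icc (-β) β, qm a x ∈ Ioo (-β) β) :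
    ∀ᶠ α in 𝓝[>] (0 : ℝ), Traps a β α := by
  obtain ⟨z, hz, hmax⟩ := isCompact_Icc.exists_isMaxOn (nonempty_Icc.2 (by linarith : -β ≤ β))
    (continuous_qm a).abs.continuousOn
  have hlt : |qm a z| < β := abs_lt.2 (hβmap z hz)
  filter_upwards [Ioo_mem_nhdsGT (sub_pos.2 hlt)] with α hα x hx s hs
  have h1 : |qm a x| ≤ |qm a z| := hmax hx
  have h2 : |α * s| ≤ α := by
    rw [abs_mul, abs_of_pos hα.1]; exact mul_le_of_le_one_right hα.1.le hs
  rw [mem_Icc, ← abs_le]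
  calc |qm a x + α * s| ≤ |qm a x| + |α * s| := abs_add_le _ _
    _ ≤ β := by linarith [hα.2]

theorem fn_mem_Icc {a β α : ℝ} {d : ℕ} {φ : ℝ → ℝ} (hB : Traps a β α) (hφb : ∀ θ, |φ θ| ≤ 1)
    (n : ℕ) (θ : ℝ) {x : ℝ} (hx : x ∈ Icc (-β) β) : fn a d φ α n θ x ∈ Icc (-β) β := by
  induction n with
  | zero => exact hx
  | succ n ih => rw [fn_succ]; exact hB _ ih _ (hφb _)

theorem iterate_mem_Icc {a β : ℝ} (hβmap : ∀ x ∈ Icc (-β) β, qm a x ∈ Ioo (-β) β)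
    (n : ℕ) {x : ℝ} (hx : x ∈ Icc (-β) β) : (qm a)^[n] x ∈ Icc (-β) β := by
  induction n with
  | zero => exact hx
  | succ n ih => rw [Function.iterate_succ_apply']; exact Ioo_subset_Icc_self (hβmap _ ih)

/-- Perturbed and unperturbed orbits stay close for boundedly many steps. -/
theorem exists_abs_fn_sub_iterate_le {a β : ℝ} (hβ : 0 ≤ β) (d : ℕ) {φ : ℝ → ℝ}
    (hφb : ∀ θ, |φ θ| ≤ 1)
    (hβmap : ∀ x ∈ Icc (-β) β, qm a x ∈ Ioo (-β) β) (i : ℕ) :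
    ∃ C, 0 ≤ C ∧ ∀ α, 0 < α → Traps a β α → ∀ θ, ∀ x ∈ Icc (-β) β, ∀ y ∈ Icc (-β) β,
      |fn a d φ α i θ x - (qm a)^[i] y| ≤ C * (|x - y| + α) := by
  induction i with
  | zero =>
    refine ⟨1, zero_le_one, fun α hα _ θ x _ y _ => ?_⟩
    simp only [fn_zero, Function.iterate_zero, id]
    linarith
  | succ i ih =>
    obtain ⟨C, hC, h⟩ := ih
    refine ⟨2 * β * C + 1, by positivity, fun α hα hB θ x hx y hy => ?_⟩
    have hu := fn_mem_Icc (d := d) hB hφb i θ hx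
    have hv := iterate_mem_Icc hβmap i hy
    have h1 := h α hα hB θ x hx y hy
    rw [fn_succ, Function.iterate_succ_apply']
    set u := fn a d φ α i θ x
    set v := (qm a)^[i] y
    have e : qm a u + α * φ ((d : ℝ) ^ i * θ) - qm a v
        = -((u + v) * (u - v)) + α * φ ((d : ℝ) ^ i * θ) := by unfold qm; ring
    have h2 : |u + v| ≤ 2 * β := abs_le.2 ⟨by linarith [hu.1, hv.1], by linarith [hu.2, hv.2]⟩
    have h3 : |α * φ ((d : ℝ) ^ i * θ)| ≤ α := by
      rw [abs_mul, abs_of_pos hα]; exact mul_le_of_le_one_right hα.le (hφb _)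
    rw [e]
    calc _ ≤ |-((u + v) * (u - v))| + |α * φ ((d : ℝ) ^ i * θ)| := abs_add_le _ _
      _ ≤ 2 * β * (C * (|x - y| + α)) + α := by
          rw [abs_neg, abs_mul]; gcongr
      _ ≤ _ := by nlinarith [abs_nonneg (x - y)]

theorem exists_lipschitz_of_periodic {φ : ℝ → ℝ} (hφa : ∀ x : ℝ, AnalyticAt ℝ φ x)
    (hφp : Function.Periodic φ 1) : ∃ K, 0 ≤ K ∧ ∀ x y, |φ x - φ y| ≤ K * |x - y| := by
  have hc : ContDiff ℝ 1 φ := contDiff_iff_contDiffAt.2 fun x => (hφa x).contDiffAt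
  have hd : Continuous (deriv φ) := hc.continuous_deriv le_rfl
  have hp : Function.Periodic (deriv φ) 1 := fun x => by
    rw [← deriv_comp_add_const]
    congr 1
    exact funext hφp
  obtain ⟨K, hK⟩ := (isCompact_Icc (a := (0 : ℝ)) (b := 1)).exists_bound_of_continuousOn
    hd.continuousOn
  have hK' : ∀ x, ‖deriv φ x‖ ≤ K := fun x => by
    obtain ⟨y, hy, e⟩ := hp.exists_mem_Ico₀ one_pos x
    rw [e]; exact hK y (Ico_subset_Icc_self hy)
  refine ⟨K, (norm_nonneg _).trans (hK' 0), fun x y => ?_⟩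
  exact convex_univ.norm_image_sub_le_of_norm_deriv_le (f := φ)
    (fun x _ => (hφa x).differentiableAt) (fun x _ => hK' x) (mem_univ y) (mem_univ x)

theorem differentiable_fn (a : ℝ) (d : ℕ) (φ : ℝ → ℝ) (α : ℝ) (n : ℕ) (θ : ℝ) :
    Differentiable ℝ (fun y => fn a d φ α n θ y) := by
  induction n with
  | zero => exact differentiable_id
  | succ n ih => simp only [fn_succ, qm]; fun_prop

/-- Fibre derivatives growing at a rate below the base expansion bound the oscillation of
`θ ↦ f_q(θ, x)` on intervals of length comparable to `d ^ (-q)`. -/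
theorem abs_fn_sub_fn_le {a β α : ℝ} {d : ℕ} {φ : ℝ → ℝ} (hd : 2 ≤ d)
    (hα : 0 < α) (hB : Traps a β α) (hφb : ∀ θ, |φ θ| ≤ 1) {K C R : ℝ} (hC : 0 < C)
    (hR : R ∈ Ioo (0 : ℝ) 2) (hK : 0 ≤ K) (hlip : ∀ x y, |φ x - φ y| ≤ K * |x - y|)
    (hder : ∀ θ, ∀ x ∈ Icc (-β) β, ∀ k, |deriv (fun y => fn a d φ α k θ y) x| ≤ C * R ^ k)
    {q : ℕ} {σ σ' x : ℝ} (hx : x ∈ Icc (-β) β) (hσ : |σ - σ'| * (d : ℝ) ^ q ≤ 2) :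
    |fn a d φ α q σ x - fn a d φ α q σ' x| ≤ 2 * K * C / (2 - R) * α := by
  have hdR : (2 : ℝ) ≤ d := by exact_mod_cast hd
  have hR2 : 0 < 2 - R := by linarith [hR.2]
  have hR0 := hR.1
  have hlipx : ∀ k θ, ∀ u ∈ Icc (-β) β, ∀ v ∈ Icc (-β) β,
      |fn a d φ α k θ u - fn a d φ α k θ v| ≤ C * R ^ k * |u - v| := fun k θ u hu v hv =>
    (convex_Icc _ _).norm_image_sub_le_of_norm_deriv_le (f := fun y => fn a d φ α k θ y)
      (fun x _ => differentiable_fn a d φ α k θ x) (fun x hx => hder θ x hx k) hv hu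
  suffices H : ∀ q : ℕ, ∀ σ σ' x : ℝ, x ∈ Icc (-β) β →
      |fn a d φ α q σ x - fn a d φ α q σ' x| ≤
        K * C / (2 - R) * α * (((d : ℝ) ^ q - R ^ q) * |σ - σ'|) by
    refine (H q σ σ' x hx).trans ?_
    calc _ ≤ K * C / (2 - R) * α * 2 := by
          gcongr
          nlinarith [mul_nonneg (pow_nonneg hR0.le q) (abs_nonneg (σ - σ'))]
      _ = _ := by ring
  intro q
  induction q with
  | zero => intro σ σ' x _; simp [fn_zero]
  | succ q ih =>
    intro σ σ' x hx
    rw [fn_succ', fn_succ']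
    have hx1 := hB x hx _ (hφb σ)
    have hx2 := hB x hx _ (hφb σ')
    set x1 := qm a x + α * φ σ with hx1_def
    set x2 := qm a x + α * φ σ' with hx2_def
    have e : |x1 - x2| ≤ α * (K * |σ - σ'|) := by
      rw [hx1_def, hx2_def, add_sub_add_left_eq_sub, ← mul_sub, abs_mul, abs_of_pos hα]
      exact mul_le_mul_of_nonneg_left (hlip _ _) hα.le
    have h1 := ih (d * σ) (d * σ') x1 hx1
    rw [← mul_sub, abs_mul, abs_of_nonneg (by linarith : (0 : ℝ) ≤ d)] at h1
    calc |fn a d φ α q (d * σ) x1 - fn a d φ α q (d * σ') x2|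
        ≤ |fn a d φ α q (d * σ) x1 - fn a d φ α q (d * σ') x1|
          + |fn a d φ α q (d * σ') x1 - fn a d φ α q (d * σ') x2| := abs_sub_le _ _ _
      _ ≤ K * C / (2 - R) * α * (((d : ℝ) ^ q - R ^ q) * (d * |σ - σ'|))
          + C * R ^ q * (α * (K * |σ - σ'|)) :=
          add_le_add h1 ((hlipx q _ x1 hx1 x2 hx2).trans (by gcongr))
      _ = K * C / (2 - R) * α * (((d : ℝ) ^ q * d - R ^ q * (d - 2 + R)) * |σ - σ'|) := by
          field_simp; ring
      _ ≤ _ := by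
          rw [pow_succ, pow_succ]
          gcongr
          linarith

theorem IEnd_le {a α : ℝ} (hα : 0 < α) (n : ℕ) : (IEnd a α n).1 ≤ (IEnd a α n).2 := by
  induction n with
  | zero => simp only [IEnd]; linarith
  | succ n ih =>
    have hK := (isCompact_Icc (a := (IEnd a α n).1) (b := (IEnd a α n).2)).image (continuous_qm a)
    have h := csInf_le_csSup ((nonempty_Icc.2 ih).image _) hK.bddBelow hK.bddAbove
    simp only [IEnd]
    linarith

theorem mem_Iseq {a α : ℝ} {n : ℕ} {x : ℝ} :
    x ∈ Iseq a α (n + 1) ↔ (IEnd a α n).1 ≤ x ∧ x ≤ (IEnd a α n).2 := Iff.rfl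

theorem mem_Iseq_one {a α x s : ℝ} (hx : x ^ 2 ≤ α) (hs : |s| ≤ α) :
    qm a x + s ∈ Iseq a α 1 := by
  rw [mem_Iseq]
  have := abs_le.1 hs
  simp only [IEnd, qm]
  constructor <;> nlinarith [sq_nonneg x]

theorem mem_Iseq_succ {a α x s : ℝ} {n : ℕ} (hx : x ∈ Iseq a α (n + 1)) (hs : |s| ≤ α) :
    qm a x + s ∈ Iseq a α (n + 2) := by
  have hK := (isCompact_Icc (a := (IEnd a α n).1) (b := (IEnd a α n).2)).image (continuous_qm a)
  have h1 := csInf_le hK.bddBelow (mem_image_of_mem (qm a) hx)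
  have h2 := le_csSup hK.bddAbove (mem_image_of_mem (qm a) hx)
  have := abs_le.1 hs
  rw [mem_Iseq]
  simp only [IEnd]
  constructor <;> linarith

theorem iterate_mem_Iseq {a α : ℝ} (hα : 0 < α) (n : ℕ) :
    (qm a)^[n + 1] 0 ∈ Iseq a α (n + 1) := by
  induction n with
  | zero => simpa using mem_Iseq_one (a := a) (x := 0) (s := 0) (by simpa using hα.le) (by simpa using hα.le)
  | succ n ih =>
    rw [Function.iterate_succ_apply']
    simpa using mem_Iseq_succ (s := 0) ih (by simpa using hα.le)

theorem abs_sub_le_len {a α x y : ℝ} {n : ℕ} (hx : x ∈ Iseq a α (n + 1))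
    (hy : y ∈ Iseq a α (n + 1)) : |x - y| ≤ len a α n := by
  rw [mem_Iseq] at hx hy
  unfold len
  exact abs_le.2 ⟨by linarith, by linarith⟩

theorem left_mem_Iseq {a α : ℝ} (hα : 0 < α) (n : ℕ) : (IEnd a α n).1 ∈ Iseq a α (n + 1) :=
  left_mem_Icc.2 (IEnd_le hα n)

theorem right_mem_Iseq {a α : ℝ} (hα : 0 < α) (n : ℕ) : (IEnd a α n).2 ∈ Iseq a α (n + 1) :=
  right_mem_Icc.2 (IEnd_le hα n)

theorem len_zero (a α : ℝ) : len a α 0 = 4 * α := by simp only [len, IEnd]; ring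

theorem two_mul_le_len {a α : ℝ} (hα : 0 < α) (n : ℕ) : 2 * α ≤ len a α n := by
  cases n with
  | zero => rw [len_zero]; linarith
  | succ n =>
    have hK := (isCompact_Icc (a := (IEnd a α n).1) (b := (IEnd a α n).2)).image (continuous_qm a)
    have h := csInf_le_csSup ((nonempty_Icc.2 (IEnd_le hα n)).image _) hK.bddBelow hK.bddAbove
    simp only [len, IEnd]
    linarith

theorem len_nonneg {a α : ℝ} (hα : 0 < α) (n : ℕ) : 0 ≤ len a α n := by
  linarith [two_mul_le_len (a := a) hα n]

theorem len_succ_le {a α : ℝ} (hα : 0 < α) (n : ℕ) :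
    len a α (n + 1) ≤ 2 * (|(qm a)^[n + 1] 0| + len a α n) * len a α n + 2 * α := by
  have hK := (isCompact_Icc (a := (IEnd a α n).1) (b := (IEnd a α n).2)).image (continuous_qm a)
  have hne := (nonempty_Icc.2 (IEnd_le (a := a) hα n)).image (qm a)
  obtain ⟨x, hx, ex⟩ := hK.sSup_mem hne
  obtain ⟨y, hy, ey⟩ := hK.sInf_mem hne
  have e : len a α (n + 1) = (y + x) * (y - x) + 2 * α := by
    simp only [len, IEnd, ← ex, ← ey, qm]; ring
  have bound : ∀ z ∈ Iseq a α (n + 1), |z| ≤ |(qm a)^[n + 1] 0| + len a α n := fun z hz => by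
    have := abs_sub_abs_le_abs_sub z ((qm a)^[n + 1] 0)
    linarith [abs_sub_le_len hz (iterate_mem_Iseq hα n)]
  have hxy : |y + x| ≤ 2 * (|(qm a)^[n + 1] 0| + len a α n) := by
    linarith [abs_add_le y x, bound x hx, bound y hy]
  have := abs_sub_le_len (a := a) (α := α) (n := n) hy hx
  rw [e]
  refine add_le_add_left ?_ _
  calc _ ≤ |(y + x) * (y - x)| := le_abs_self _
    _ ≤ _ := by
        rw [abs_mul]
        exact mul_le_mul hxy this (abs_nonneg _) ((abs_nonneg _).trans hxy)

/-- If `I_{n+1}` avoids the critical point then `f` is monotone there and the length of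
`I_{n+2}` is exactly determined. -/
theorem len_succ {a α : ℝ} (hα : 0 < α) {n : ℕ} (h0 : (0 : ℝ) ∉ Iseq a α (n + 1)) :
    len a α (n + 1) = |(IEnd a α n).1 + (IEnd a α n).2| * len a α n + 2 * α := by
  have hle := IEnd_le (a := a) hα n
  rw [mem_Iseq, not_and_or, not_le, not_le] at h0
  simp only [len, IEnd]
  set l := (IEnd a α n).1
  set r := (IEnd a α n).2
  rcases h0 with h | h
  · have h1 : IsGreatest (qm a '' Icc l r) (qm a l) :=
      ⟨mem_image_of_mem _ (left_mem_Icc.2 hle), by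
        rintro _ ⟨x, hx, rfl⟩; unfold qm; nlinarith [hx.1, hx.2]⟩
    have h2 : IsLeast (qm a '' Icc l r) (qm a r) :=
      ⟨mem_image_of_mem _ (right_mem_Icc.2 hle), by
        rintro _ ⟨x, hx, rfl⟩; unfold qm; nlinarith [hx.1, hx.2]⟩
    rw [h1.csSup_eq, h2.csInf_eq, abs_of_pos (by linarith)]
    unfold qm; ring
  · have h1 : IsGreatest (qm a '' Icc l r) (qm a r) :=
      ⟨mem_image_of_mem _ (right_mem_Icc.2 hle), by
        rintro _ ⟨x, hx, rfl⟩; unfold qm; nlinarith [hx.1, hx.2]⟩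
    have h2 : IsLeast (qm a '' Icc l r) (qm a l) :=
      ⟨mem_image_of_mem _ (left_mem_Icc.2 hle), by
        rintro _ ⟨x, hx, rfl⟩; unfold qm; nlinarith [hx.1, hx.2]⟩
    rw [h1.csSup_eq, h2.csInf_eq, abs_of_neg (by linarith)]
    unfold qm; ring

theorem tendsto_len (a : ℝ) (n : ℕ) : Tendsto (fun α => len a α n) (𝓝[>] 0) (𝓝 0) := by
  have hid : Tendsto (fun α : ℝ => α) (𝓝[>] 0) (𝓝 0) := tendsto_nhdsWithin_of_tendsto_nhds tendsto_id
  induction n with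
  | zero => simpa [len_zero] using hid.const_mul 4
  | succ n ih =>
    have h : Tendsto (fun α => 2 * (|(qm a)^[n + 1] 0| + len a α n) * len a α n + 2 * α)
        (𝓝[>] 0) (𝓝 0) := by
      simpa using (((ih.const_add |(qm a)^[n + 1] 0|).const_mul 2).mul ih).add (hid.const_mul 2)
    refine squeeze_zero' ?_ ?_ h
    · filter_upwards [self_mem_nhdsWithin] with α hα using len_nonneg hα _
    · filter_upwards [self_mem_nhdsWithin] with α hα using len_succ_le hα _

theorem bddAbove_Nal {a ξ₀ α : ℝ} (hα : 0 < α) :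
    BddAbove {N : ℕ | (∀ n : ℕ, 1 ≤ n → n ≤ N → len a α (n - 1) < ξ₀) ∧
      ∑ n ∈ Finset.range N, len a α n ≤ ξ₀} := by
  refine ⟨⌊ξ₀ / (2 * α)⌋₊, fun N hN => Nat.le_floor ?_⟩
  rw [le_div_iff₀ (by positivity)]
  calc (N : ℝ) * (2 * α) = ∑ _n ∈ Finset.range N, 2 * α := by simp
    _ ≤ ∑ n ∈ Finset.range N, len a α n := Finset.sum_le_sum fun n _ => two_mul_le_len hα n
    _ ≤ ξ₀ := hN.2

theorem Nal_spec {a ξ₀ α : ℝ} (hξ₀ : 0 < ξ₀) (hα : 0 < α) :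
    (∀ n < Nal a ξ₀ α, len a α n < ξ₀) ∧ ∑ n ∈ Finset.range (Nal a ξ₀ α), len a α n ≤ ξ₀ := by
  have h := Nat.sSup_mem ⟨0, by simpa using ⟨fun n h1 h2 => by omega, hξ₀.le⟩⟩
    (bddAbove_Nal (a := a) (ξ₀ := ξ₀) hα)
  exact ⟨fun n hn => h.1 (n + 1) (by omega) hn, h.2⟩

theorem le_sum_len_Nal {a ξ₀ α : ℝ} (hα : 0 < α) :
    ξ₀ ≤ ∑ n ∈ Finset.range (Nal a ξ₀ α + 1), len a α n := by
  by_contra! hlt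
  have : Nal a ξ₀ α + 1 ≤ Nal a ξ₀ α := by
    refine le_csSup (bddAbove_Nal hα) ⟨fun n h1 h2 => ?_, hlt.le⟩
    refine lt_of_le_of_lt ?_ hlt
    exact Finset.single_le_sum (f := fun n => len a α n) (fun i _ => len_nonneg hα i)
      (Finset.mem_range.2 (by omega : n - 1 < Nal a ξ₀ α + 1))
  omega

theorem eventually_le_Nal (a : ℝ) {ξ₀ : ℝ} (hξ₀ : 0 < ξ₀) (K : ℕ) :
    ∀ᶠ α in 𝓝[>] (0 : ℝ), K ≤ Nal a ξ₀ α := by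
  have hsum : Tendsto (fun α => ∑ n ∈ Finset.range K, len a α n) (𝓝[>] 0) (𝓝 0) := by
    simpa using tendsto_finsetSum (Finset.range K) fun n _ => tendsto_len a n
  filter_upwards [hsum.eventually (gt_mem_nhds hξ₀), self_mem_nhdsWithin] with α hα hα0
  refine le_csSup (bddAbove_Nal hα0) ⟨fun n h1 h2 => ?_, hα.le⟩
  refine lt_of_le_of_lt ?_ hα
  exact Finset.single_le_sum (f := fun n => len a α n) (fun i _ => len_nonneg hα0 i)
    (Finset.mem_range.2 (by omega : n - 1 < K))

/-- The derivative of `f^n` at the critical value. -/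
def critProd (a : ℝ) (n : ℕ) : ℝ := ∏ i ∈ Finset.range n, -(2 * (qm a)^[i + 1] 0)

theorem critProd_ne_zero {a ξ₀ : ℝ} (hξ₀ : 0 < ξ₀) (hc : ∀ i, 2 * ξ₀ ≤ |(qm a)^[i + 1] 0|)
    (n : ℕ) : critProd a n ≠ 0 := by
  refine Finset.prod_ne_zero_iff.2 fun i _ => ?_
  have : (qm a)^[i + 1] 0 ≠ 0 := abs_pos.1 (by linarith [hc i])
  simpa using this

theorem exp_half_sub_one_le : Real.exp (1 / 2) - 1 ≤ 2 / 3 := by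
  have h1 : Real.exp (1 / 2) * Real.exp (1 / 2) = Real.exp 1 := by rw [← Real.exp_add]; norm_num
  nlinarith [Real.exp_one_lt_d9, Real.exp_pos (1 / 2)]

/-- Bounded distortion along the shadowing intervals. -/
theorem abs_prod_div_critProd_sub_one_le {a ξ₀ α : ℝ} (hξ₀ : 0 < ξ₀) (hα : 0 < α)
    (hc : ∀ i, 2 * ξ₀ ≤ |(qm a)^[i + 1] 0|) {n : ℕ}
    (hsum : ∑ i ∈ Finset.range n, len a α i ≤ ξ₀) {u v : ℕ → ℝ}
    (hu : ∀ i < n, u i ∈ Iseq a α (i + 1)) (hv : ∀ i < n, v i ∈ Iseq a α (i + 1)) :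
    |(∏ i ∈ Finset.range n, -(u i + v i)) / critProd a n - 1| ≤ 2 / 3 ∧
    |(∏ i ∈ Finset.range n, -(u i + v i)) / critProd a n - 1| ≤
      (∑ i ∈ Finset.range n, len a α i) / ξ₀ := by
  set c : ℕ → ℝ := fun i => (qm a)^[i + 1] 0
  set s : ℕ → ℝ := fun i => (u i - c i + (v i - c i)) / (2 * c i)
  have hc0 : ∀ i, c i ≠ 0 := fun i => abs_pos.1 (by linarith [hc i])
  have hs : ∀ i < n, ‖s i‖ ≤ len a α i / (2 * ξ₀) := fun i hi => by
    have h1 := abs_sub_le_len (hu i hi) (iterate_mem_Iseq hα i)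
    have h2 := abs_sub_le_len (hv i hi) (iterate_mem_Iseq hα i)
    have h3 : 4 * ξ₀ ≤ |2 * c i| := by rw [abs_mul, abs_two]; linarith [hc i]
    calc ‖s i‖ = |u i - c i + (v i - c i)| / |2 * c i| := abs_div _ _
      _ ≤ (2 * len a α i) / (4 * ξ₀) := by
          have := len_nonneg (a := a) hα i
          gcongr
          linarith [abs_add_le (u i - c i) (v i - c i)]
      _ = _ := by field_simp; ring
  have hsS : ∑ i ∈ Finset.range n, ‖s i‖ ≤ (∑ i ∈ Finset.range n, len a α i) / (2 * ξ₀) := by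
    rw [Finset.sum_div]
    exact Finset.sum_le_sum fun i hi => hs i (Finset.mem_range.1 hi)
  have hS : (∑ i ∈ Finset.range n, len a α i) / (2 * ξ₀) ≤ 1 / 2 := by
    rw [div_le_div_iff₀ (by positivity) two_pos]; linarith
  have hprod : (∏ i ∈ Finset.range n, -(u i + v i)) / critProd a n
      = ∏ i ∈ Finset.range n, (1 + s i) := by
    rw [critProd, ← Finset.prod_div_distrib]
    refine Finset.prod_congr rfl fun i _ => ?_
    have := hc0 i
    simp only [s, c] at this ⊢
    field_simp
    ring
  have h := Finset.norm_prod_one_add_sub_one_le (Finset.range n) s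
  rw [hprod]
  have h0 : 0 ≤ ∑ i ∈ Finset.range n, ‖s i‖ := Finset.sum_nonneg fun _ _ => norm_nonneg _
  refine ⟨h.trans ?_, h.trans ?_⟩
  · exact (sub_le_sub_right (Real.exp_le_exp.2 (hsS.trans hS)) _).trans exp_half_sub_one_le
  · have := Real.abs_exp_sub_one_le (x := ∑ i ∈ Finset.range n, ‖s i‖)
      (by rw [abs_of_nonneg h0]; linarith)
    rw [abs_of_nonneg h0] at this
    calc _ ≤ _ := le_abs_self _
      _ ≤ _ := this
      _ ≤ 2 * ((∑ i ∈ Finset.range n, len a α i) / (2 * ξ₀)) := by gcongr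
      _ = _ := by field_simp

theorem sum_len_le {a ξ₀ α : ℝ} (hα : 0 < α) {m n : ℕ} (hmn : m ≤ n)
    (hsum : ∑ i ∈ Finset.range n, len a α i ≤ ξ₀) : ∑ i ∈ Finset.range m, len a α i ≤ ξ₀ :=
  (Finset.sum_le_sum_of_subset_of_nonneg (Finset.range_subset_range.2 hmn)
    fun i _ _ => len_nonneg hα i).trans hsum

theorem abs_prod_bounds {a ξ₀ α : ℝ} (hξ₀ : 0 < ξ₀) (hα : 0 < α)
    (hc : ∀ i, 2 * ξ₀ ≤ |(qm a)^[i + 1] 0|) {n : ℕ}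
    (hsum : ∑ i ∈ Finset.range n, len a α i ≤ ξ₀) {u v : ℕ → ℝ}
    (hu : ∀ i < n, u i ∈ Iseq a α (i + 1)) (hv : ∀ i < n, v i ∈ Iseq a α (i + 1)) :
    |critProd a n| / 3 ≤ |∏ i ∈ Finset.range n, -(u i + v i)| ∧
    |∏ i ∈ Finset.range n, -(u i + v i)| ≤ 2 * |critProd a n| := by
  have hQ := critProd_ne_zero hξ₀ hc n
  have h := abs_le.1 (abs_prod_div_critProd_sub_one_le hξ₀ hα hc hsum hu hv).1
  set r := (∏ i ∈ Finset.range n, -(u i + v i)) / critProd a n with hr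
  have e : ∏ i ∈ Finset.range n, -(u i + v i) = r * critProd a n := by
    rw [hr, div_mul_cancel₀ _ hQ]
  rw [e, abs_mul, abs_of_pos (by linarith : 0 < r)]
  have := abs_pos.2 hQ
  constructor <;> nlinarith

theorem abs_inv_prod_sub_inv_critProd_le {a ξ₀ α : ℝ} (hξ₀ : 0 < ξ₀) (hα : 0 < α)
    (hc : ∀ i, 2 * ξ₀ ≤ |(qm a)^[i + 1] 0|) {n : ℕ}
    (hsum : ∑ i ∈ Finset.range n, len a α i ≤ ξ₀) {u v : ℕ → ℝ}
    (hu : ∀ i < n, u i ∈ Iseq a α (i + 1)) (hv : ∀ i < n, v i ∈ Iseq a α (i + 1)) :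
    |(∏ i ∈ Finset.range n, -(u i + v i))⁻¹ - (critProd a n)⁻¹| ≤ 2 * |critProd a n|⁻¹ ∧
    |(∏ i ∈ Finset.range n, -(u i + v i))⁻¹ - (critProd a n)⁻¹| ≤
      3 * ((∑ i ∈ Finset.range n, len a α i) / ξ₀) * |critProd a n|⁻¹ := by
  have hQ := critProd_ne_zero hξ₀ hc n
  obtain ⟨h1, h2⟩ := abs_prod_div_critProd_sub_one_le hξ₀ hα hc hsum hu hv
  set r := (∏ i ∈ Finset.range n, -(u i + v i)) / critProd a n with hr
  have e : ∏ i ∈ Finset.range n, -(u i + v i) = r * critProd a n := by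
    rw [hr, div_mul_cancel₀ _ hQ]
  have hr3 : 1 / 3 ≤ r := by linarith [(abs_le.1 h1).1]
  have e2 : |(r * critProd a n)⁻¹ - (critProd a n)⁻¹| = |r - 1| * r⁻¹ * |critProd a n|⁻¹ := by
    have : (r * critProd a n)⁻¹ - (critProd a n)⁻¹ = -((r - 1) * r⁻¹ * (critProd a n)⁻¹) := by
      have : r ≠ 0 := by linarith
      field_simp
      ring
    rw [this, abs_neg, abs_mul, abs_mul, abs_inv, abs_inv, abs_of_pos (by linarith : 0 < r)]
  have hri : r⁻¹ ≤ 3 := by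
    rw [inv_le_comm₀ (by linarith) (by norm_num)]; linarith
  have hri0 : 0 ≤ r⁻¹ := by positivity
  have key : ∀ b : ℝ, |r - 1| ≤ b → |r - 1| * r⁻¹ * |critProd a n|⁻¹ ≤ 3 * b * |critProd a n|⁻¹ :=
    fun b hb => by
      refine mul_le_mul_of_nonneg_right ?_ (by positivity)
      nlinarith [abs_nonneg (r - 1)]
  rw [e, e2]
  refine ⟨(key _ h1).trans_eq (by ring), key _ h2⟩

theorem linear_recursion_eq {x h b : ℕ → ℝ} {N : ℕ}
    (hx : ∀ n < N, x (n + 1) = h n * x n + b n) (hh : ∀ n < N, h n ≠ 0) {n : ℕ} (hn : n ≤ N) :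
    x n = (∏ i ∈ Finset.range n, h i) *
      (x 0 + ∑ i ∈ Finset.range n, b i * (∏ j ∈ Finset.range (i + 1), h j)⁻¹) := by
  induction n with
  | zero => simp
  | succ n ih =>
    have hne : ∏ j ∈ Finset.range (n + 1), h j ≠ 0 :=
      Finset.prod_ne_zero_iff.2 fun i hi => hh i (by have := Finset.mem_range.1 hi; omega)
    rw [hx n hn, ih (by omega), Finset.sum_range_succ, ← add_assoc,
      mul_add (∏ i ∈ Finset.range (n + 1), h i), mul_left_comm _ (b n), mul_inv_cancel₀ hne,
      mul_one, Finset.prod_range_succ]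
    ring

theorem lt_abs_of_mem_Iseq {a ξ₀ α : ℝ} (hα : 0 < α)
    (hc : ∀ i, 2 * ξ₀ ≤ |(qm a)^[i + 1] 0|) {n : ℕ} (hn : len a α n < ξ₀) {x : ℝ}
    (hx : x ∈ Iseq a α (n + 1)) : ξ₀ < |x| := by
  have h1 := abs_sub_le_len (iterate_mem_Iseq hα n) hx
  have h2 := abs_sub_abs_le_abs_sub ((qm a)^[n + 1] 0) x
  linarith [hc n]

theorem len_eq {a ξ₀ α : ℝ} (hξ₀ : 0 < ξ₀) (hα : 0 < α)
    (hc : ∀ i, 2 * ξ₀ ≤ |(qm a)^[i + 1] 0|) {m k : ℕ} (hmk : m + k ≤ Nal a ξ₀ α) :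
    len a α (m + k) = (∏ i ∈ Finset.range k, |(IEnd a α (m + i)).1 + (IEnd a α (m + i)).2|) *
      (len a α m + ∑ i ∈ Finset.range k, 2 * α *
        (∏ j ∈ Finset.range (i + 1), |(IEnd a α (m + j)).1 + (IEnd a α (m + j)).2|)⁻¹) := by
  have hlt := (Nal_spec (a := a) hξ₀ hα).1
  refine linear_recursion_eq (N := k) (x := fun k => len a α (m + k)) (fun n hn => ?_)
    (fun n hn => ?_) le_rfl
  · refine len_succ hα fun h0 => ?_
    have := lt_abs_of_mem_Iseq hα hc (hlt (m + n) (by omega)) h0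
    rw [abs_zero] at this
    linarith
  · rw [abs_ne_zero]
    intro h0
    have hle := IEnd_le (a := a) hα (m + n)
    refine absurd (lt_abs_of_mem_Iseq hα hc (hlt (m + n) (by omega)) (x := 0) ?_) ?_
    · rw [mem_Iseq]; constructor <;> linarith
    · rw [abs_zero]; linarith

theorem prod_abs_endpoints_bounds {a ξ₀ α : ℝ} (hξ₀ : 0 < ξ₀) (hα : 0 < α)
    (hc : ∀ i, 2 * ξ₀ ≤ |(qm a)^[i + 1] 0|) {m k : ℕ} (hmk : m + k ≤ Nal a ξ₀ α) :
    |critProd a (m + k)| / (6 * |critProd a m|) ≤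
        ∏ i ∈ Finset.range k, |(IEnd a α (m + i)).1 + (IEnd a α (m + i)).2| ∧
    ∏ i ∈ Finset.range k, |(IEnd a α (m + i)).1 + (IEnd a α (m + i)).2| ≤
        6 * |critProd a (m + k)| / |critProd a m| := by
  set E : ℕ → ℝ := fun n => ∏ i ∈ Finset.range n, |(IEnd a α i).1 + (IEnd a α i).2|
  have hE : ∀ n ≤ Nal a ξ₀ α, |critProd a n| / 3 ≤ E n ∧ E n ≤ 2 * |critProd a n| := fun n hn => by
    have := abs_prod_bounds hξ₀ hα hc (sum_len_le hα hn (Nal_spec hξ₀ hα).2)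
      (fun i _ => left_mem_Iseq hα i) (fun i _ => right_mem_Iseq hα i)
    simpa only [Finset.abs_prod, abs_neg] using this
  have hD : ∀ n, 0 < |critProd a n| := fun n => abs_pos.2 (critProd_ne_zero hξ₀ hc n)
  obtain ⟨h1, h2⟩ := hE m (by omega)
  obtain ⟨h3, h4⟩ := hE (m + k) hmk
  have hm := hD m
  have hmk' := hD (m + k)
  have hEm : 0 < E m := by linarith
  have e : E (m + k) = E m * ∏ i ∈ Finset.range k, |(IEnd a α (m + i)).1 + (IEnd a α (m + i)).2| :=
    Finset.prod_range_add _ _ _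
  set P := ∏ i ∈ Finset.range k, |(IEnd a α (m + i)).1 + (IEnd a α (m + i)).2|
  have hP : 0 ≤ P := Finset.prod_nonneg fun _ _ => abs_nonneg _
  rw [e] at h3 h4
  constructor
  · rw [div_le_iff₀ (by positivity)]
    nlinarith [mul_le_mul_of_nonneg_right h2 hP]
  · rw [le_div_iff₀ hm]
    nlinarith [mul_le_mul_of_nonneg_right h1 hP]

theorem len_le_of_summable {a ξ₀ α : ℝ} (hξ₀ : 0 < ξ₀) (hα : 0 < α)
    (hc : ∀ i, 2 * ξ₀ ≤ |(qm a)^[i + 1] 0|) (hs : Summable fun n => |critProd a n|⁻¹)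
    {k : ℕ} (hk : k ≤ Nal a ξ₀ α) :
    len a α k ≤ 72 * (∑' n, |critProd a n|⁻¹) * α * |critProd a k| := by
  have h := len_eq hξ₀ hα hc (m := 0) (k := k) (by omega)
  have hP := fun n (hn : n ≤ Nal a ξ₀ α) =>
    prod_abs_endpoints_bounds hξ₀ hα hc (m := 0) (k := n) (by omega)
  have h1 : critProd a 0 = 1 := by simp [critProd]
  have hD : ∀ n, 0 < |critProd a n| := fun n => abs_pos.2 (critProd_ne_zero hξ₀ hc n)
  simp only [zero_add, h1, abs_one, mul_one, div_one, len_zero] at h hP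
  rw [h]
  have hsum : ∑ i ∈ Finset.range (k + 1), |critProd a i|⁻¹ ≤ ∑' n, |critProd a n|⁻¹ :=
    hs.sum_le_tsum _ fun i _ => by positivity
  rw [Finset.sum_range_succ', h1, abs_one, inv_one] at hsum
  have hb : ∀ i ∈ Finset.range k, 2 * α * (∏ j ∈ Finset.range (i + 1),
      |(IEnd a α j).1 + (IEnd a α j).2|)⁻¹ ≤ 12 * α * |critProd a (i + 1)|⁻¹ := fun i hi => by
    have hi := Finset.mem_range.1 hi
    have h6 := (hP (i + 1) (by omega)).1
    have := hD (i + 1)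
    calc _ ≤ 2 * α * (|critProd a (i + 1)| / 6)⁻¹ := by gcongr
      _ = _ := by field_simp; ring
  calc _ ≤ 6 * |critProd a k| *
        (4 * α + ∑ i ∈ Finset.range k, 12 * α * |critProd a (i + 1)|⁻¹) := by
        have := Finset.sum_le_sum hb
        have h0 : 0 ≤ ∑ i ∈ Finset.range k, 2 * α * (∏ j ∈ Finset.range (i + 1),
          |(IEnd a α j).1 + (IEnd a α j).2|)⁻¹ := Finset.sum_nonneg fun i _ => by positivity
        exact mul_le_mul (hP k hk).2 (by linarith) (by positivity) (by positivity)
    _ ≤ 6 * |critProd a k| * (12 * α * ∑' n, |critProd a n|⁻¹) := by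
        rw [← Finset.mul_sum]
        gcongr
        nlinarith
    _ = _ := by ring

theorem len_add_le {a ξ₀ α : ℝ} (hξ₀ : 0 < ξ₀) (hα : 0 < α)
    (hc : ∀ i, 2 * ξ₀ ≤ |(qm a)^[i + 1] 0|) {C : ℝ}
    (hC : ∀ n k, |critProd a (n + k)| ≤ C * |critProd a n|)
    {m k : ℕ} (hmk : m + k ≤ Nal a ξ₀ α) :
    len a α (m + k) ≤ 36 * C * (len a α m + 2 * α * k) := by
  rw [len_eq hξ₀ hα hc hmk]
  have hD : ∀ n, 0 < |critProd a n| := fun n => abs_pos.2 (critProd_ne_zero hξ₀ hc n)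
  have hC0 : 0 ≤ C := by have := hC 0 0; have := hD 0; rw [add_zero] at *; nlinarith
  have hP := fun n (hn : n ≤ k) =>
    prod_abs_endpoints_bounds hξ₀ hα hc (m := m) (k := n) (by omega)
  set P : ℕ → ℝ := fun n =>
    ∏ i ∈ Finset.range n, |(IEnd a α (m + i)).1 + (IEnd a α (m + i)).2|
  have hm := hD m
  have hb : ∀ i ∈ Finset.range k, P k * (2 * α * (P (i + 1))⁻¹) ≤ 36 * C * (2 * α) := fun i hi => by
    have hi := Finset.mem_range.1 hi
    have h1 := (hP (i + 1) (by omega)).1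
    have h2 := (hP k le_rfl).2
    have h3 := hC (m + (i + 1)) (k - (i + 1))
    rw [show m + (i + 1) + (k - (i + 1)) = m + k by omega] at h3
    have h4 := hD (m + (i + 1))
    have h5 := hD (m + k)
    calc _ ≤ 6 * |critProd a (m + k)| / |critProd a m| *
          (2 * α * (|critProd a (m + (i + 1))| / (6 * |critProd a m|))⁻¹) := by gcongr
      _ = 36 * (2 * α) * (|critProd a (m + k)| / |critProd a (m + (i + 1))|) := by
          field_simp; ring
      _ ≤ 36 * (2 * α) * C := by
          gcongr
          rwa [div_le_iff₀ h4]
      _ = _ := by ring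
  have hk : P k ≤ 36 * C := by
    refine (hP k le_rfl).2.trans ?_
    rw [div_le_iff₀ hm]
    nlinarith [hC m k]
  change P k * (len a α m + ∑ i ∈ Finset.range k, 2 * α * (P (i + 1))⁻¹) ≤ _
  rw [mul_add, mul_add, Finset.mul_sum]
  refine add_le_add (mul_le_mul_of_nonneg_right hk (len_nonneg hα m)) ?_
  calc _ ≤ ∑ _i ∈ Finset.range k, 36 * C * (2 * α) := Finset.sum_le_sum hb
    _ = _ := by rw [Finset.sum_const, Finset.card_range, nsmul_eq_mul]; ring

/-- Without expansion along the critical orbit, the last shadowing interval is short. -/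
theorem eventually_len_Nal_lt {a ξ₀ : ℝ} (hξ₀ : 0 < ξ₀)
    (hc : ∀ i, 2 * ξ₀ ≤ |(qm a)^[i + 1] 0|) {C : ℝ}
    (hC : ∀ n k, |critProd a (n + k)| ≤ C * |critProd a n|) {κ : ℝ} (hκ : 0 < κ) :
    ∀ᶠ α in 𝓝[>] (0 : ℝ), len a α (Nal a ξ₀ α) < κ := by
  have hC0 : 0 < C := by
    have h := hC 0 0
    have h1 : critProd a 0 = 1 := by simp [critProd]
    rw [add_zero, h1, abs_one] at h
    linarith
  set η := κ / (72 * C) with hη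
  have hη0 : 0 < η := by positivity
  obtain ⟨K, hK⟩ := exists_nat_gt (ξ₀ / η)
  have hsmall : ∀ᶠ α in 𝓝[>] (0 : ℝ), α < η / (2 * (K + 1)) :=
    eventually_nhdsWithin_of_eventually_nhds (gt_mem_nhds (by positivity))
  filter_upwards [self_mem_nhdsWithin, eventually_le_Nal a hξ₀ K, hsmall] with α hα hN hα2
  rw [mem_Ioi] at hα
  by_contra! hge
  set N := Nal a ξ₀ α
  have hterm : ∀ i ∈ Finset.range K, η ≤ len a α (N - K + i) := fun i hi => by
    have hi := Finset.mem_range.1 hi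
    have h := len_add_le hξ₀ hα hc hC (m := N - K + i) (k := K - i) (by omega)
    rw [show N - K + i + (K - i) = N by omega] at h
    have h2 : 2 * η ≤ len a α (N - K + i) + 2 * α * (K - i : ℕ) := by
      have : κ = 36 * C * (2 * η) := by rw [hη]; field_simp; norm_num
      exact le_of_mul_le_mul_left (by linarith) (by positivity : 0 < 36 * C)
    have h3 : ((K - i : ℕ) : ℝ) ≤ K + 1 := by
      have : ((K - i : ℕ) : ℝ) ≤ K := by exact_mod_cast Nat.sub_le _ _
      linarith
    rw [lt_div_iff₀ (by positivity)] at hα2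
    nlinarith
  have hsum := (Nal_spec (a := a) hξ₀ hα).2
  change ∑ n ∈ Finset.range N, len a α n ≤ ξ₀ at hsum
  rw [show N = N - K + K by omega, Finset.sum_range_add] at hsum
  have h1 : (K : ℝ) * η ≤ ∑ i ∈ Finset.range K, len a α (N - K + i) := by
    simpa using Finset.sum_le_sum hterm
  have h2 : 0 ≤ ∑ i ∈ Finset.range (N - K), len a α i :=
    Finset.sum_nonneg fun i _ => len_nonneg hα i
  rw [div_lt_iff₀ hη0] at hK
  linarith

theorem exists_bounds_of_eventually_periodic {E : ℕ → ℝ} (hE : ∀ n, 0 < E n) {m p : ℕ}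
    (hp : 1 ≤ p) (h : ∀ n, m ≤ n → E (n + p) = E n) :
    ∃ c C : ℝ, 0 < c ∧ 0 < C ∧ ∀ n, c ≤ E n ∧ E n ≤ C := by
  have hfin : ∀ n, ∃ i < m + p, E n = E i := fun n => by
    induction n using Nat.strong_induction_on with
    | _ n ih =>
      by_cases hn : n < m + p
      · exact ⟨n, hn, rfl⟩
      · obtain ⟨i, hi, e⟩ := ih (n - p) (by omega)
        refine ⟨i, hi, ?_⟩
        rw [← e, ← h (n - p) (by omega), Nat.sub_add_cancel (by omega)]
  have hne : (Finset.range (m + p)).Nonempty := Finset.nonempty_range_iff.2 (by omega)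
  obtain ⟨i₁, -, h₁⟩ := (Finset.range (m + p)).exists_min_image E hne
  obtain ⟨i₂, -, h₂⟩ := (Finset.range (m + p)).exists_max_image E hne
  refine ⟨E i₁, E i₂, hE _, hE _, fun n => ?_⟩
  obtain ⟨i, hi, e⟩ := hfin n
  rw [e]
  exact ⟨h₁ i (Finset.mem_range.2 hi), h₂ i (Finset.mem_range.2 hi)⟩

/-- Along a pre-periodic critical orbit the derivatives either do not grow or grow
exponentially. -/
theorem critProd_dichotomy {a ξ₀ : ℝ} (hξ₀ : 0 < ξ₀) (hc : ∀ i, 2 * ξ₀ ≤ |(qm a)^[i + 1] 0|)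
    {m p : ℕ} (hp : 1 ≤ p) (hmp : (qm a)^[m + p] 0 = (qm a)^[m] 0) :
    (∃ C, ∀ n k, |critProd a (n + k)| ≤ C * |critProd a n|) ∨
    (Summable (fun n => |critProd a n|⁻¹) ∧
      ∃ C, ∀ N, ∑ n ∈ Finset.range (N + 1), |critProd a n| ≤ C * |critProd a N|) := by
  have hD : ∀ n, 0 < |critProd a n| := fun n => abs_pos.2 (critProd_ne_zero hξ₀ hc n)
  set g : ℕ → ℝ := fun i => |-(2 * (qm a)^[i + 1] 0)| with hg_def
  have hg : ∀ i, 0 < g i := fun i => by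
    simp only [g, abs_neg, abs_mul, abs_two]; linarith [hc i]
  have hgp : ∀ i, m ≤ i → g (i + p) = g i := fun i hi => by
    have : (qm a)^[i + p + 1] 0 = (qm a)^[i + 1] 0 := by
      rw [show i + p + 1 = (i + 1 - m) + (m + p) by omega, Function.iterate_add_apply, hmp,
        ← Function.iterate_add_apply, Nat.sub_add_cancel (by omega)]
    simp only [g, this]
  set Λ : ℕ → ℝ := fun n => ∏ i ∈ Finset.range p, g (n + i) with hΛ_def
  have hDΛ : ∀ n, |critProd a (n + p)| = |critProd a n| * Λ n := fun n => by
    simp only [critProd, Finset.prod_range_add, abs_mul, Finset.abs_prod, Λ, g]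
  have hΛpos : ∀ n, 0 < Λ n := fun n => Finset.prod_pos fun i _ => hg _
  have hΛ : ∀ n, m ≤ n → Λ n = Λ m := fun n hn => by
    induction n, hn using Nat.le_induction with
    | base => rfl
    | succ n hn ih =>
      rw [← ih]
      have h1 : ∏ i ∈ Finset.range (p + 1), g (n + i) = Λ n * g (n + p) := Finset.prod_range_succ ..
      have h2 : ∏ i ∈ Finset.range (p + 1), g (n + i) = Λ (n + 1) * g n := by
        rw [Finset.prod_range_succ', add_zero]
        congr 1
        exact Finset.prod_congr rfl fun i _ => by rw [show n + (i + 1) = n + 1 + i by omega]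
      rw [h1, hgp n hn] at h2
      exact (mul_right_cancel₀ (hg n).ne' h2).symm
  set μ : ℝ := (Λ m) ^ ((p : ℝ)⁻¹) with hμ_def
  have hμ : 0 < μ := Real.rpow_pos_of_pos (hΛpos m) _
  have hμp : μ ^ p = Λ m := Real.rpow_inv_natCast_pow (hΛpos m).le (by omega)
  obtain ⟨c, C, hc0, hC0, hcC⟩ := exists_bounds_of_eventually_periodic
    (E := fun n => |critProd a n| / μ ^ n) (fun n => div_pos (hD n) (pow_pos hμ n)) hp
    (m := m) fun n hn => by
      simp only [hDΛ, hΛ n hn, pow_add, hμp]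
      have := (hΛpos m).ne'
      field_simp
  have hlow : ∀ n, c * μ ^ n ≤ |critProd a n| := fun n => by
    simpa [le_div_iff₀ (pow_pos hμ n)] using (hcC n).1
  have hup : ∀ n, |critProd a n| ≤ C * μ ^ n := fun n => by
    simpa [div_le_iff₀ (pow_pos hμ n)] using (hcC n).2
  rcases le_or_gt μ 1 with h1 | h1
  · refine Or.inl ⟨C / c, fun n k => ?_⟩
    calc |critProd a (n + k)| ≤ C * μ ^ (n + k) := hup _
      _ ≤ C * μ ^ n := by
        gcongr 1
        exact pow_le_pow_of_le_one hμ.le h1 (by omega)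
      _ = C / c * (c * μ ^ n) := by field_simp
      _ ≤ _ := by gcongr; exact hlow n
  · refine Or.inr ⟨?_, C * μ / (μ - 1) / c, fun N => ?_⟩
    · refine Summable.of_nonneg_of_le (fun n => by positivity) (fun n => ?_)
        ((summable_geometric_of_lt_one (inv_nonneg.2 hμ.le) (inv_lt_one_of_one_lt₀ h1)).mul_left c⁻¹)
      rw [inv_pow, ← mul_inv]
      exact inv_anti₀ (by positivity) (hlow n)
    · have h2 : 0 < μ - 1 := sub_pos.2 h1
      calc ∑ n ∈ Finset.range (N + 1), |critProd a n|
          ≤ ∑ n ∈ Finset.range (N + 1), C * μ ^ n := Finset.sum_le_sum fun n _ => hup n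
        _ = C * ((μ ^ (N + 1) - 1) / (μ - 1)) := by
            rw [← Finset.mul_sum, geom_sum_eq h1.ne']
        _ ≤ C * (μ ^ (N + 1) / (μ - 1)) := by gcongr; linarith
        _ = C * μ / (μ - 1) / c * (c * μ ^ N) := by rw [pow_succ]; field_simp
        _ ≤ _ := by gcongr; exact hlow N

/-- `G` is a `1`-periodic set, of measure at most `2/3` per period, containing every point within
`d ^ (-s)` of the base point of an orbit returning close to `0` at some time `s ≤ T`. -/
def IsExceptional (a : ℝ) (d : ℕ) (φ : ℝ → ℝ) (α : ℝ) (T : ℕ) (G : Set ℝ) : Prop :=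
  (∀ t : ℝ, ∀ j : ℕ, t + j ∈ G ↔ t ∈ G) ∧ volume (G ∩ Ico 0 1) ≤ 2 / 3 ∧
    ∀ τ τ' y : ℝ, ∀ s : ℕ, 1 ≤ s → s ≤ T → |y| ≤ 2 * α ^ (0.6 : ℝ) →
      |fn a d φ α s τ y| ≤ α ^ (0.6 : ℝ) → |τ - τ'| * (d : ℝ) ^ s < 1 → τ' ∈ G

theorem fn_succ_mem_Iseq {a α : ℝ} {d : ℕ} {φ : ℝ → ℝ} (hα : 0 < α) (hφb : ∀ θ, |φ θ| ≤ 1)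
    {y : ℝ} (hy : y ^ 2 ≤ α) (τ : ℝ) (n : ℕ) : fn a d φ α (n + 1) τ y ∈ Iseq a α (n + 1) := by
  have hs : ∀ t, |α * φ t| ≤ α := fun t => by
    rw [abs_mul, abs_of_pos hα]; exact mul_le_of_le_one_right hα.le (hφb t)
  induction n with
  | zero => rw [fn_succ]; exact mem_Iseq_one hy (hs _)
  | succ n ih => rw [fn_succ]; exact mem_Iseq_succ ih (hs _)

/-- An orbit starting near the critical point does not come back during the first `N(α)` steps. -/
theorem Nal_lt_of_abs_fn_le {a ξ₀ α : ℝ} {d : ℕ} {φ : ℝ → ℝ} (hξ₀ : 0 < ξ₀) (hα : 0 < α)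
    (hc : ∀ i, 2 * ξ₀ ≤ |(qm a)^[i + 1] 0|) (hφb : ∀ θ, |φ θ| ≤ 1) {y τ : ℝ} (hy : y ^ 2 ≤ α)
    {s : ℕ} (hs : 1 ≤ s) (h : |fn a d φ α s τ y| ≤ ξ₀) : Nal a ξ₀ α < s := by
  by_contra! hle
  obtain ⟨n, rfl⟩ := Nat.exists_eq_add_of_le' hs
  exact h.not_gt (lt_abs_of_mem_Iseq hα hc ((Nal_spec hξ₀ hα).1 n hle)
    (fn_succ_mem_Iseq hα hφb hy τ n))

theorem eventually_rpow_le {r κ : ℝ} (hr : 0 < r) (hκ : 0 < κ) :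
    ∀ᶠ α in 𝓝[>] (0 : ℝ), α ^ r ≤ κ := by
  have h : Tendsto (fun α : ℝ => α ^ r) (𝓝[>] 0) (𝓝 0) := by
    have := (Real.continuousAt_rpow_const 0 r (Or.inr hr.le)).tendsto
    rw [Real.zero_rpow hr.ne'] at this
    exact this.mono_left nhdsWithin_le_nhds
  exact h.eventually (eventually_le_nhds hκ)

theorem sq_two_mul_rpow {α : ℝ} (hα : 0 < α) :
    (2 * α ^ (0.6 : ℝ)) ^ 2 = 4 * α ^ (0.2 : ℝ) * α := by
  rw [mul_pow, ← Real.rpow_natCast, ← Real.rpow_natCast, ← Real.rpow_mul hα.le, mul_assoc,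
    ← Real.rpow_add_one hα.ne']
  norm_num

theorem sq_le_four_mul_rpow {α y : ℝ} (hα : 0 < α) (hy : |y| ≤ 2 * α ^ (0.6 : ℝ)) :
    y ^ 2 ≤ 4 * α ^ (0.2 : ℝ) * α := by
  rw [← sq_two_mul_rpow hα, ← sq_abs]
  gcongr

theorem eventually_isExceptional_empty {a β ξ₀ : ℝ} {d : ℕ} {φ : ℝ → ℝ} (hβ : 0 < β)
    (hβmap : ∀ x ∈ Icc (-β) β, qm a x ∈ Ioo (-β) β) (hφb : ∀ θ, |φ θ| ≤ 1) (hξ₀ : 0 < ξ₀)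
    (hc : ∀ i, 2 * ξ₀ ≤ |(qm a)^[i + 1] 0|) {C : ℝ}
    (hC : ∀ n k, |critProd a (n + k)| ≤ C * |critProd a n|) (M : ℕ) :
    ∀ᶠ α in 𝓝[>] (0 : ℝ), IsExceptional a d φ α (Nal a ξ₀ α + M) ∅ := by
  choose C' hC'0 hC' using exists_abs_fn_sub_iterate_le hβ.le d hφb hβmap
  set S := ∑ i ∈ Finset.range M, C' i with hS_def
  have hS0 : 0 ≤ S := Finset.sum_nonneg fun i _ => hC'0 i
  have hS : ∀ i < M, C' i ≤ S := fun i hi =>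
    Finset.single_le_sum (fun i _ => hC'0 i) (Finset.mem_range.2 hi)
  set κ := ξ₀ / (2 * (S + 1)) with hκ_def
  have hκ : 0 < κ := by positivity
  have hSκ : S * (κ + κ) < ξ₀ := by
    rw [hκ_def, ← two_mul, ← mul_assoc, mul_div_assoc', div_lt_iff₀ (by positivity)]
    nlinarith
  filter_upwards [eventually_len_Nal_lt hξ₀ hc hC hκ, eventually_traps hβ.le hβmap,
    eventually_rpow_le (r := 0.6) (by norm_num) hξ₀,
    eventually_rpow_le (r := 0.6) (by norm_num) (half_pos hβ),
    eventually_rpow_le (r := 0.2) (κ := 1 / 4) (by norm_num) (by norm_num),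
    Ioo_mem_nhdsGT hκ] with α hlen hB h1 h2 h3 hα'
  have hα : 0 < α := hα'.1
  refine ⟨by simp, by simp, fun τ τ' y s hs hsT hy hret _ => ?_⟩
  have hy2 : y ^ 2 ≤ α := (sq_le_four_mul_rpow hα hy).trans (by nlinarith)
  have hlt := Nal_lt_of_abs_fn_le hξ₀ hα hc hφb hy2 hs (hret.trans h1)
  obtain ⟨i, rfl⟩ := Nat.exists_eq_add_of_le' (Nat.succ_le_of_lt hlt)
  have hyB : y ∈ Icc (-β) β := abs_le.1 (hy.trans (by linarith))
  have h0B : (0 : ℝ) ∈ Icc (-β) β := ⟨by linarith, hβ.le⟩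
  set N := Nal a ξ₀ α
  have h4 := hC' i α hα hB ((d : ℝ) ^ (N + 1) * τ) _ (fn_mem_Icc (d := d) hB hφb (N + 1) τ hyB)
    _ (iterate_mem_Icc hβmap (N + 1) h0B)
  rw [← fn_add, ← Function.iterate_add_apply] at h4
  have h5 := abs_sub_le_len (a := a) (fn_succ_mem_Iseq (d := d) hα hφb hy2 τ N) (iterate_mem_Iseq hα N)
  have h6 : |fn a d φ α (i + (N + 1)) τ y - (qm a)^[i + (N + 1)] 0| ≤ S * (κ + κ) :=
    h4.trans (mul_le_mul (hS i (by omega)) (by linarith [hα'.2]) (by positivity) hS0)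
  have h7 := hc (i + N)
  rw [add_assoc] at h7
  have h8 := abs_sub_abs_le_abs_sub ((qm a)^[i + (N + 1)] 0) (fn a d φ α (i + (N + 1)) τ y)
  rw [abs_sub_comm] at h8
  linarith

theorem measure_zeros_eq_zero {g : ℝ → ℝ} (hg : ∀ x, AnalyticAt ℝ g x) {x₀ : ℝ} (h : g x₀ ≠ 0) :
    volume {x | g x = 0} = 0 := by
  have h1 := AnalyticOnNhd.preimage_zero_mem_codiscrete (fun x _ => hg x) h
  have h2 := ae_restrict_le_codiscreteWithin (μ := volume) MeasurableSet.univ h1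
  rw [Measure.restrict_univ, mem_ae_iff] at h2
  convert h2 using 2
  ext x
  simp

theorem eq_of_eventually_periodic {g : ℝ → ℝ} (hg : Continuous g) {p : ℕ → ℝ}
    (hp : ∀ k, 0 < p k) (hp0 : Tendsto p atTop (𝓝 0))
    (h : ∀ᶠ k in atTop, Function.Periodic g (p k)) (x y : ℝ) : g x = g y := by
  have h1 : Tendsto (fun k => x + ⌊(y - x) / p k⌋ * p k) atTop (𝓝 y) := by
    have hlow : Tendsto (fun k => y - p k) atTop (𝓝 y) := by simpa using hp0.const_sub y
    refine tendsto_of_tendsto_of_tendsto_of_le_of_le hlow tendsto_const_nhds (fun k => ?_)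
      fun k => ?_
    · have := (div_lt_iff₀ (hp k)).1 (Int.lt_floor_add_one ((y - x) / p k))
      simp only
      linarith
    · have := (le_div_iff₀ (hp k)).1 (Int.floor_le ((y - x) / p k))
      simp only
      linarith
  refine tendsto_nhds_unique (tendsto_const_nhds.congr' ?_) ((hg.tendsto y).comp h1)
  filter_upwards [h] with k hk
  simpa using (hk.int_mul ⌊(y - x) / p k⌋ x).symm

theorem tendsto_inv_pow_zero {d : ℕ} (hd : 2 ≤ d) :
    Tendsto (fun k : ℕ => ((d : ℝ) ^ k)⁻¹) atTop (𝓝 0) := by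
  have : (1 : ℝ) < d := by exact_mod_cast hd
  exact tendsto_inv_atTop_zero.comp (tendsto_pow_atTop_atTop_of_one_lt this)

/-- The weighted sum of `φ` along the orbit of `t` under multiplication by `d`. -/
def orbitSum (d : ℕ) (φ : ℝ → ℝ) (w : ℕ → ℝ) (t : ℝ) : ℝ := ∑' n, w n * φ ((d : ℝ) ^ n * t)

theorem norm_mul_apply_le {φ : ℝ → ℝ} (hφb : ∀ θ, |φ θ| ≤ 1) (w t : ℝ) : ‖w * φ t‖ ≤ |w| := by
  rw [norm_mul]
  exact mul_le_of_le_one_right (abs_nonneg w) (hφb t)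

theorem summable_mul {φ : ℝ → ℝ} (hφb : ∀ θ, |φ θ| ≤ 1) {w : ℕ → ℝ}
    (hw : Summable fun n => |w n|) (t : ℕ → ℝ) : Summable fun n => w n * φ (t n) :=
  Summable.of_norm_bounded hw fun n => norm_mul_apply_le hφb (w n) (t n)

theorem continuous_orbitSum (d : ℕ) {φ : ℝ → ℝ} (hφ : Continuous φ) (hφb : ∀ θ, |φ θ| ≤ 1)
    {w : ℕ → ℝ} (hw : Summable fun n => |w n|) : Continuous (orbitSum d φ w) :=
  continuous_tsum (fun _ => by fun_prop) hw fun n _ => norm_mul_apply_le hφb (w n) _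

theorem periodic_orbitSum (d : ℕ) {φ : ℝ → ℝ} (hφp : Function.Periodic φ 1) (w : ℕ → ℝ) :
    Function.Periodic (orbitSum d φ w) 1 := fun t => by
  refine tsum_congr fun n => ?_
  have := hφp.add_natCast ((d : ℝ) ^ n * t) (d ^ n)
  push_cast at this
  rw [mul_add, mul_one, this]

theorem abs_orbitSum_le (d : ℕ) {φ : ℝ → ℝ} (hφb : ∀ θ, |φ θ| ≤ 1) {w : ℕ → ℝ}
    (hw : Summable fun n => |w n|) (t : ℝ) : |orbitSum d φ w t| ≤ ∑' n, |w n| :=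
  tsum_of_norm_bounded hw.hasSum fun n => norm_mul_apply_le hφb (w n) _

theorem orbitSum_not_const {d : ℕ} (hd : 2 ≤ d) {φ : ℝ → ℝ} (hφ : Continuous φ)
    (hφp : Function.Periodic φ 1) (hφnc : ∃ s t, φ s ≠ φ t) (hφb : ∀ θ, |φ θ| ≤ 1) {w : ℕ → ℝ}
    (hw : Summable fun n => |w n|) (hw0 : w 0 = 1) :
    ∃ s t, orbitSum d φ w s ≠ orbitSum d φ w t := by
  by_contra! hconst
  have hd0 : (0 : ℝ) < d := by positivity
  have hφ_eq : ∀ t, φ t = orbitSum d φ w t - ∑' n, w (n + 1) * φ ((d : ℝ) ^ (n + 1) * t) :=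
    fun t => by
      rw [orbitSum, (summable_mul hφb hw _).tsum_eq_zero_add]
      simp [hw0]
  have hper : ∀ k : ℕ, Function.Periodic φ ((d : ℝ) ^ k)⁻¹ := fun k => by
    induction k with
    | zero => simpa using hφp
    | succ k ih =>
      intro t
      rw [hφ_eq, hφ_eq t, hconst _ t]
      congr 1
      refine tsum_congr fun n => ?_
      congr 1
      have := ih.nat_mul (d ^ n) ((d : ℝ) ^ (n + 1) * t)
      rw [← this]
      congr 1
      push_cast
      field_simp
      ring
  obtain ⟨s, t, hst⟩ := hφnc
  exact hst (eq_of_eventually_periodic hφ (fun k => by positivity) (tendsto_inv_pow_zero hd)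
    (.of_forall hper) s t)

theorem measure_orbitSum_eq_zero {d : ℕ} (hd : 2 ≤ d) {φ : ℝ → ℝ}
    (hφa : ∀ x, AnalyticAt ℝ φ x)
    (hφp : Function.Periodic φ 1) (hφnc : ∃ s t, φ s ≠ φ t) (hφb : ∀ θ, |φ θ| ≤ 1) {w : ℕ → ℝ}
    (hw : Summable fun n => |w n|) (hw0 : w 0 = 1) (x : ℝ) :
    volume {t | t ∈ Ico (0 : ℝ) 1 ∧ orbitSum d φ w t = x} = 0 := by
  have hφ : Continuous φ := continuous_iff_continuousAt.2 fun x => (hφa x).continuousAt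
  have hd0 : (0 : ℝ) < d := by positivity
  have hcont := continuous_orbitSum d hφ hφb hw
  set Φ := orbitSum d φ w with hΦ
  set D : ℕ → ℝ → ℝ := fun k t => Φ (t + ((d : ℝ) ^ k)⁻¹) - Φ t with hD
  have hDa : ∀ k t, AnalyticAt ℝ (D k) t := fun k => by
    have : D k = fun t => ∑ i ∈ Finset.range k,
        (w i * φ ((d : ℝ) ^ i * (t + ((d : ℝ) ^ k)⁻¹)) - w i * φ ((d : ℝ) ^ i * t)) := by
      funext t
      rw [hD, hΦ]
      simp only [orbitSum]
      rw [← (summable_mul hφb hw _).tsum_sub (summable_mul hφb hw _)]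
      refine tsum_eq_sum fun i hi => ?_
      have hki : k ≤ i := by simpa using hi
      have := hφp.add_natCast ((d : ℝ) ^ i * t) (d ^ (i - k))
      push_cast at this
      rw [mul_add, ← pow_sub₀ _ hd0.ne' hki, this, sub_self]
    rw [this]
    intro t
    refine Finset.analyticAt_fun_sum _ fun i _ => ?_
    exact (analyticAt_const.mul ((hφa _).fun_comp (by fun_prop))).sub
      (analyticAt_const.mul ((hφa _).fun_comp (by fun_prop)))
  set A := {t | t ∈ Ico (0 : ℝ) 1 ∧ Φ t = x} with hA
  have hAm : MeasurableSet A :=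
    measurableSet_Ico.inter (isClosed_eq hcont continuous_const).measurableSet
  have hAfin : volume A ≠ ∞ :=
    ((measure_mono fun t ht => ht.1).trans_lt (measure_Ico_lt_top (a := (0 : ℝ)) (b := 1))).ne
  set Z := ⋃ k : ℕ, {t | D k t = 0 ∧ ∃ s, D k s ≠ 0} with hZ
  have hZ0 : volume Z = 0 := measure_iUnion_null fun k => by
    by_cases h : ∃ s, D k s ≠ 0
    · obtain ⟨s, hs⟩ := h
      exact measure_mono_null (fun t ht => ht.1) (measure_zeros_eq_zero (hDa k) hs)
    · simp [h]
  by_contra hpos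
  obtain ⟨Z', hZZ', hZ'm, hZ'0⟩ := exists_measurable_superset_of_null hZ0
  have hE : volume (A \ Z') = volume A := measure_sdiff_null hZ'0
  have hst := Measure.sub_mem_nhds_zero_of_addHaar_pos_ne_top volume (A \ Z') (hAm.diff hZ'm)
    (hE ▸ pos_iff_ne_zero.2 hpos) (hE ▸ hAfin)
  obtain ⟨s, t, hne⟩ := orbitSum_not_const hd hφ hφp hφnc hφb hw hw0
  refine hne (eq_of_eventually_periodic hcont (fun k => by positivity) (tendsto_inv_pow_zero hd)
    ?_ s t)
  filter_upwards [(tendsto_inv_pow_zero hd).eventually hst] with k hk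
  obtain ⟨u, hu, v, hv, huv⟩ := hk
  have hvu : v + ((d : ℝ) ^ k)⁻¹ = u := by rw [← huv]; ring
  have h0 : D k v = 0 := by
    simp only [hD, hvu, hu.1.2, hv.1.2, sub_self]
  intro t
  by_contra hne
  exact hv.2 (hZZ' (mem_iUnion.2 ⟨k, h0, t, sub_ne_zero.2 hne⟩))

theorem exists_measure_orbitSum_near_le {d : ℕ} (hd : 2 ≤ d) {φ : ℝ → ℝ}
    (hφa : ∀ x, AnalyticAt ℝ φ x)
    (hφp : Function.Periodic φ 1) (hφnc : ∃ s t, φ s ≠ φ t) (hφb : ∀ θ, |φ θ| ≤ 1) {w : ℕ → ℝ}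
    (hw : Summable fun n => |w n|) (hw0 : w 0 = 1) {κ : ℝ≥0∞} (hκ : κ ≠ 0) :
    ∃ ε > 0, ∀ x, volume {t | t ∈ Ico (0 : ℝ) 1 ∧ |orbitSum d φ w t - x| ≤ ε} ≤ κ := by
  have hφ : Continuous φ := continuous_iff_continuousAt.2 fun x => (hφa x).continuousAt
  have hcont := continuous_orbitSum d hφ hφb hw
  have hbound := abs_orbitSum_le d hφb hw
  have hzero := measure_orbitSum_eq_zero hd hφa hφp hφnc hφb hw hw0
  set Φ := orbitSum d φ w
  set W := ∑' n, |w n|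
  by_contra! hbad
  choose x hx using fun n : ℕ => hbad (1 / ((n : ℝ) + 1)) Nat.one_div_pos_of_nat
  have hxB : ∀ n, x n ∈ Icc (-(W + 1)) (W + 1) := fun n => by
    obtain ⟨t, -, ht⟩ := nonempty_of_measure_ne_zero (pos_of_gt (hx n)).ne'
    have h1 : 1 / ((n : ℝ) + 1) ≤ 1 := by
      rw [div_le_one (by positivity)]; linarith [n.cast_nonneg (α := ℝ)]
    have h2 := hbound t
    rw [abs_le] at ht h2
    exact ⟨by linarith, by linarith⟩
  obtain ⟨x₀, -, ψ, hψ, hlim⟩ := isCompact_Icc.tendsto_subseq hxB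
  set S : ℕ → Set ℝ := fun m => {t | t ∈ Ico (0 : ℝ) 1 ∧ |Φ t - x₀| ≤ 1 / ((m : ℝ) + 1)} with hS
  have hSm : ∀ m, MeasurableSet (S m) := fun m => measurableSet_Ico.inter
    (isClosed_le (hcont.sub continuous_const).abs continuous_const).measurableSet
  have hanti : Antitone S := fun m n hmn t ht =>
    ⟨ht.1, ht.2.trans (Nat.one_div_le_one_div hmn)⟩
  have hSκ : ∀ m, κ ≤ volume (S m) := fun m => by
    have hm : (0 : ℝ) < 1 / ((m : ℝ) + 1) / 2 := by positivity
    have h1 := hlim.eventually (Metric.closedBall_mem_nhds x₀ hm)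
    have h2 := (tendsto_one_div_add_atTop_nhds_zero_nat (𝕜 := ℝ)).comp hψ.tendsto_atTop
    obtain ⟨n, hn1, hn2⟩ := (h1.and (h2.eventually (eventually_le_nhds hm))).exists
    refine (hx (ψ n)).le.trans (measure_mono fun t ht => ⟨ht.1, ?_⟩)
    have h3 := abs_sub_le (Φ t) (x (ψ n)) x₀
    have h4 : |x (ψ n) - x₀| ≤ 1 / ((m : ℝ) + 1) / 2 := hn1
    have h5 : 1 / ((ψ n : ℝ) + 1) ≤ 1 / ((m : ℝ) + 1) / 2 := hn2
    linarith [ht.2]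
  have hlim' := tendsto_measure_iInter_atTop (μ := volume) (fun m => (hSm m).nullMeasurableSet)
    hanti ⟨0, ((measure_mono fun t ht => ht.1).trans_lt
      (measure_Ico_lt_top (a := (0 : ℝ)) (b := 1))).ne⟩
  have hle := ge_of_tendsto' hlim' hSκ
  have hint : volume (⋂ m, S m) = 0 := by
    refine measure_mono_null (fun t ht => ?_) (hzero x₀)
    rw [mem_iInter] at ht
    refine ⟨(ht 0).1, sub_eq_zero.1 (abs_nonpos_iff.1 ?_)⟩
    exact ge_of_tendsto' (tendsto_one_div_add_atTop_nhds_zero_nat (𝕜 := ℝ)) fun m => (ht m).2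
  exact hκ (nonpos_iff_eq_zero.1 (hint ▸ hle))

theorem Function.Periodic.uniformContinuous {g : ℝ → ℝ} (hp : Function.Periodic g 1)
    (hg : Continuous g) : UniformContinuous g := by
  have h1 : Continuous (hp.lift : AddCircle (1 : ℝ) → ℝ) :=
    continuous_coinduced_dom.2 hg
  exact (CompactSpace.uniformContinuous_of_continuous h1).comp
    (uniformContinuous_addMonoidHom_of_continuous
      (f := QuotientAddGroup.mk' (AddSubgroup.zmultiples (1 : ℝ))) continuous_quot_mk)

theorem finite_iterate_eq_zero (a : ℝ) (i : ℕ) : {x | (qm a)^[i] x = 0}.Finite := by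
  induction i with
  | zero => simp
  | succ i ih =>
    refine Finite.preimage' (f := qm a) ih fun b _ =>
      ((finite_singleton (-√(a - b))).insert (√(a - b))).subset fun x hx => ?_
    have hx' : a - x ^ 2 = b := hx
    have : x ^ 2 = √(a - b) ^ 2 := by
      rw [Real.sq_sqrt (by nlinarith [sq_nonneg x])]; linarith
    simpa using sq_eq_sq_iff_eq_or_eq_neg.1 this

/-- Points almost mapped to the critical point in fewer than `M` steps are close to
precritical points. -/
theorem exists_near_precritical (a β : ℝ) (M : ℕ) {δ : ℝ} (hδ : 0 < δ) :
    ∃ ρ > 0, ∀ i < M, ∀ x ∈ Icc (-β) β, |(qm a)^[i] x| ≤ ρ →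
      ∃ z, (qm a)^[i] z = 0 ∧ |x - z| < δ := by
  have key : ∀ i, ∀ᶠ ρ in 𝓝[>] (0 : ℝ), ∀ x ∈ Icc (-β) β, |(qm a)^[i] x| ≤ ρ →
      ∃ z, (qm a)^[i] z = 0 ∧ |x - z| < δ := fun i => by
    set K := Icc (-β) β ∩ {x | ∀ z, (qm a)^[i] z = 0 → δ ≤ |x - z|} with hK
    have hclosed : IsClosed {x | ∀ z, (qm a)^[i] z = 0 → δ ≤ |x - z|} := by
      simp only [ofPred_forall]
      exact isClosed_iInter fun z => isClosed_iInter fun _ =>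
        isClosed_le continuous_const (by fun_prop)
    have hKc : IsCompact K := isCompact_Icc.inter_right hclosed
    have hpos : ∀ x ∈ K, 0 < |(qm a)^[i] x| := fun x hx => abs_pos.2 fun h0 =>
      hδ.not_ge (by simpa using hx.2 x h0)
    obtain ⟨r, hr, hrK⟩ := hKc.exists_forall_le' (((continuous_qm a).iterate i).abs.continuousOn)
      hpos
    filter_upwards [Ioo_mem_nhdsGT hr] with ρ hρ x hx hxρ
    by_contra! hfar
    exact (hρ.2.trans_le (hrK x ⟨hx, hfar⟩)).not_ge hxρ
  have hall := (Finset.eventually_all (Finset.range M)).2 fun i _ => key i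
  obtain ⟨ρ, h, hρ⟩ := (hall.and self_mem_nhdsWithin).exists
  exact ⟨ρ, hρ, fun i hi => h i (Finset.mem_range.2 hi)⟩

/-- The error made in replacing orbits near the critical orbit by the critical orbit itself. -/
def errSum (a ξ₀ α : ℝ) : ℝ :=
  ∑' i, min 2 (3 * ((∑ l ∈ Finset.range i, len a α l) / ξ₀)) * |critProd a i|⁻¹

theorem norm_errSum_term_le {a ξ₀ α : ℝ} (hξ₀ : 0 < ξ₀) (hα : 0 < α) (i : ℕ) :
    ‖min 2 (3 * ((∑ l ∈ Finset.range i, len a α l) / ξ₀)) * |critProd a i|⁻¹‖ ≤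
      2 * |critProd a i|⁻¹ := by
  have : 0 ≤ ∑ l ∈ Finset.range i, len a α l := Finset.sum_nonneg fun l _ => len_nonneg hα l
  rw [norm_mul, norm_inv, Real.norm_eq_abs, Real.norm_eq_abs, abs_abs,
    abs_of_nonneg (le_min (by norm_num) (by positivity))]
  gcongr
  exact min_le_left ..

theorem tendsto_errSum {a ξ₀ : ℝ} (hξ₀ : 0 < ξ₀) (hs : Summable fun n => |critProd a n|⁻¹) :
    Tendsto (errSum a ξ₀) (𝓝[>] 0) (𝓝 0) := by
  have h := tendsto_tsum_of_dominated_convergence (𝓕 := 𝓝[>] (0 : ℝ)) (hs.mul_left 2)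
    (f := fun α i => min 2 (3 * ((∑ l ∈ Finset.range i, len a α l) / ξ₀)) * |critProd a i|⁻¹)
    (g := fun _ => 0) (fun i => ?_) ?_
  · rw [tsum_zero] at h
    exact h
  · have h1 : Tendsto (fun α => ∑ l ∈ Finset.range i, len a α l) (𝓝[>] 0) (𝓝 0) := by
      simpa using tendsto_finsetSum (Finset.range i) fun l _ => tendsto_len a l
    have h2 : Tendsto (fun α => min 2 (3 * ((∑ l ∈ Finset.range i, len a α l) / ξ₀)))
        (𝓝[>] 0) (𝓝 0) := by
      have := (tendsto_const_nhds (x := (2 : ℝ))).min ((h1.div_const ξ₀).const_mul 3)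
      simpa using this
    simpa using h2.mul_const |critProd a i|⁻¹
  · filter_upwards [self_mem_nhdsWithin] with α hα i using norm_errSum_term_le hξ₀ hα i

theorem abs_orbitSum_sub_le {a ξ₀ α : ℝ} {d : ℕ} {φ : ℝ → ℝ} (hξ₀ : 0 < ξ₀) (hα : 0 < α)
    (hc : ∀ i, 2 * ξ₀ ≤ |(qm a)^[i + 1] 0|) (hs : Summable fun n => |critProd a n|⁻¹)
    (hφb : ∀ θ, |φ θ| ≤ 1) (hα1 : 4 * α ^ (0.2 : ℝ) ≤ 1) {τ τ' y y' : ℝ}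
    (hy : |y| ≤ 2 * α ^ (0.6 : ℝ)) (hy' : |y'| ≤ 2 * α ^ (0.6 : ℝ)) :
    |orbitSum d φ (fun n => (critProd a n)⁻¹) τ - orbitSum d φ (fun n => (critProd a n)⁻¹) τ'| ≤
      3 / (α * |critProd a (Nal a ξ₀ α)|) *
        |fn a d φ α (Nal a ξ₀ α + 1) τ y - fn a d φ α (Nal a ξ₀ α + 1) τ' y'|
      + 4 * α ^ (0.2 : ℝ) + 2 * errSum a ξ₀ α := by
  obtain ⟨hlen, hsum⟩ := Nal_spec (a := a) hξ₀ hα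
  have hsumN := le_sum_len_Nal (a := a) (ξ₀ := ξ₀) hα
  set N := Nal a ξ₀ α
  have hy2 := sq_le_four_mul_rpow hα hy
  have hy2' := sq_le_four_mul_rpow hα hy'
  have hu : ∀ i, fn a d φ α (i + 1) τ y ∈ Iseq a α (i + 1) :=
    fn_succ_mem_Iseq hα hφb (hy2.trans (by nlinarith)) τ
  have hv : ∀ i, fn a d φ α (i + 1) τ' y' ∈ Iseq a α (i + 1) :=
    fn_succ_mem_Iseq hα hφb (hy2'.trans (by nlinarith)) τ'
  set u : ℕ → ℝ := fun i => fn a d φ α (i + 1) τ y with hu_def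
  set v : ℕ → ℝ := fun i => fn a d φ α (i + 1) τ' y' with hv_def
  set Δ : ℕ → ℝ := fun i => φ ((d : ℝ) ^ i * τ) - φ ((d : ℝ) ^ i * τ') with hΔ
  set H : ℕ → ℝ := fun n => ∏ i ∈ Finset.range n, -(u i + v i) with hH
  have hΔ2 : ∀ i, |Δ i| ≤ 2 := fun i =>
    (abs_sub _ _).trans (by linarith [hφb ((d : ℝ) ^ i * τ), hφb ((d : ℝ) ^ i * τ')])
  have hsum' : ∀ i ≤ N, ∑ l ∈ Finset.range i, len a α l ≤ ξ₀ := fun i hi => sum_len_le hα hi hsum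
  have hHN := (abs_prod_bounds hξ₀ hα hc hsum (fun i _ => hu i) fun i _ => hv i).1
  have hDpos : ∀ i, 0 < |critProd a i| := fun i => abs_pos.2 (critProd_ne_zero hξ₀ hc i)
  have hHN0 : H N ≠ 0 := fun h0 => by
    have := hDpos N
    rw [show ∏ i ∈ Finset.range N, -(u i + v i) = 0 from h0, abs_zero] at hHN
    linarith
  set S := ∑ i ∈ Finset.range (N + 1), Δ i * (H i)⁻¹ with hS
  have hrec : u N - v N = H N * (y' ^ 2 - y ^ 2 + α * S) := by
    have hstep : ∀ n < N, u (n + 1) - v (n + 1) =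
        -(u n + v n) * (u n - v n) + α * Δ (n + 1) := fun n _ => by
      simp only [hu_def, hv_def, hΔ]
      rw [fn_succ a d φ α (n + 1), fn_succ a d φ α (n + 1) τ']
      simp only [qm]
      ring
    rw [linear_recursion_eq (x := fun n => u n - v n) (h := fun n => -(u n + v n))
      (b := fun n => α * Δ (n + 1)) hstep
      (fun n hn h0 => hHN0 (Finset.prod_eq_zero (Finset.mem_range.2 hn) h0)) le_rfl]
    congr 1
    rw [hS, Finset.sum_range_succ', mul_add, Finset.mul_sum]
    simp only [hu_def, hv_def, hΔ, hH, fn_succ, fn_zero, qm, Finset.range_zero, Finset.prod_empty,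
      mul_assoc]
    ring
  have hSle : |S| ≤ 3 / (α * |critProd a N|) * |u N - v N| + 4 * α ^ (0.2 : ℝ) := by
    have e : S = (H N)⁻¹ / α * (u N - v N) - (y' ^ 2 - y ^ 2) / α := by
      rw [hrec]; field_simp; ring
    have h1 : |(H N)⁻¹| ≤ 3 / |critProd a N| := by
      rw [abs_inv, inv_le_comm₀ (abs_pos.2 hHN0) (by have := hDpos N; positivity), inv_div]
      exact hHN
    have h2 : |y' ^ 2 - y ^ 2| ≤ 4 * α ^ (0.2 : ℝ) * α :=
      abs_sub_le_iff.2 ⟨by linarith [sq_nonneg y], by linarith [sq_nonneg y']⟩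
    rw [e]
    calc _ ≤ |(H N)⁻¹ / α * (u N - v N)| + |(y' ^ 2 - y ^ 2) / α| := abs_sub _ _
      _ = |(H N)⁻¹| / α * |u N - v N| + |y' ^ 2 - y ^ 2| / α := by
        rw [abs_mul, abs_div, abs_div, abs_of_pos hα]
      _ ≤ 3 / |critProd a N| / α * |u N - v N| + 4 * α ^ (0.2 : ℝ) * α / α := by gcongr
      _ = _ := by rw [mul_div_cancel_right₀ _ hα.ne', div_div, mul_comm α]
  have hw : Summable fun n => |(critProd a n)⁻¹| := by simpa only [abs_inv] using hs
  have hE : |S - (orbitSum d φ (fun n => (critProd a n)⁻¹) τ -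
      orbitSum d φ (fun n => (critProd a n)⁻¹) τ')| ≤ 2 * errSum a ξ₀ α := by
    have h1 : HasSum (fun i => if i ∈ Finset.range (N + 1) then Δ i * (H i)⁻¹ else 0) S := by
      rw [hS, Finset.sum_congr rfl fun i hi => (if_pos hi).symm]
      exact hasSum_sum_of_ne_finset_zero fun i hi => if_neg hi
    have h2 := (summable_mul hφb hw fun n => (d : ℝ) ^ n * τ).hasSum.sub
      (summable_mul hφb hw fun n => (d : ℝ) ^ n * τ').hasSum
    have hsm : Summable fun i =>
        min 2 (3 * ((∑ l ∈ Finset.range i, len a α l) / ξ₀)) * |critProd a i|⁻¹ :=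
      Summable.of_norm_bounded (hs.mul_left 2) (norm_errSum_term_le hξ₀ hα)
    have h3 := (h1.sub h2).norm_le_of_bounded (hsm.hasSum.mul_left 2) fun i => ?_
    · exact h3
    have hD := inv_nonneg.2 (hDpos i).le
    rw [← mul_sub, Real.norm_eq_abs]
    split_ifs with hi
    · have hiN : i ≤ N := Nat.lt_succ_iff.1 (Finset.mem_range.1 hi)
      have h4 := abs_inv_prod_sub_inv_critProd_le hξ₀ hα hc (hsum' i hiN) (fun i _ => hu i)
        fun i _ => hv i
      calc _ = |Δ i| * |(H i)⁻¹ - (critProd a i)⁻¹| := by rw [← abs_mul]; congr 1; ring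
        _ ≤ 2 * (min 2 (3 * ((∑ l ∈ Finset.range i, len a α l) / ξ₀)) * |critProd a i|⁻¹) := by
          refine mul_le_mul (hΔ2 i) ?_ (abs_nonneg _) (by norm_num)
          rw [min_mul_of_nonneg _ _ hD]
          exact le_min h4.1 h4.2
    · have hiN : N + 1 ≤ i := by simpa using hi
      have h4 : ξ₀ ≤ ∑ l ∈ Finset.range i, len a α l := hsumN.trans
        (Finset.sum_le_sum_of_subset_of_nonneg (Finset.range_subset_range.2 hiN)
          fun l _ _ => len_nonneg hα l)
      have h5 : 1 ≤ (∑ l ∈ Finset.range i, len a α l) / ξ₀ := (one_le_div hξ₀).2 h4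
      calc _ = |Δ i| * |critProd a i|⁻¹ := by rw [zero_sub, abs_neg, abs_mul, abs_inv, mul_comm]
        _ ≤ 2 * (1 * |critProd a i|⁻¹) := by rw [one_mul]; gcongr; exact hΔ2 i
        _ ≤ _ := by
          gcongr
          exact le_min (by norm_num) (by linarith)
  have := abs_sub_abs_le_abs_sub (orbitSum d φ (fun n => (critProd a n)⁻¹) τ -
      orbitSum d φ (fun n => (critProd a n)⁻¹) τ') S
  rw [abs_sub_comm _ S] at this
  linarith

theorem inv_mul_critProd_Nal_le {a ξ₀ α C : ℝ} (hξ₀ : 0 < ξ₀) (hα : 0 < α)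
    (hc : ∀ i, 2 * ξ₀ ≤ |(qm a)^[i + 1] 0|) (hs : Summable fun n => |critProd a n|⁻¹)
    (hC : ∀ N, ∑ n ∈ Finset.range (N + 1), |critProd a n| ≤ C * |critProd a N|) :
    3 / (α * |critProd a (Nal a ξ₀ α)|) ≤ 216 * (∑' n, |critProd a n|⁻¹) * C / ξ₀ := by
  have hD : 0 < |critProd a (Nal a ξ₀ α)| := abs_pos.2 (critProd_ne_zero hξ₀ hc _)
  have hW : 0 ≤ ∑' n, |critProd a n|⁻¹ := tsum_nonneg fun n => by positivity
  have h1 : ξ₀ ≤ 72 * (∑' n, |critProd a n|⁻¹) * α * (C * |critProd a (Nal a ξ₀ α)|) :=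
    calc ξ₀ ≤ ∑ n ∈ Finset.range (Nal a ξ₀ α + 1), len a α n := le_sum_len_Nal hα
      _ ≤ ∑ n ∈ Finset.range (Nal a ξ₀ α + 1),
          72 * (∑' n, |critProd a n|⁻¹) * α * |critProd a n| := Finset.sum_le_sum fun n hn =>
        len_le_of_summable hξ₀ hα hc hs (Nat.lt_succ_iff.1 (Finset.mem_range.1 hn))
      _ ≤ _ := by rw [← Finset.mul_sum]; gcongr; exact hC _
  rw [div_le_div_iff₀ (by positivity) hξ₀]
  linarith

theorem eventually_exists_isExceptional {a β ξ₀ : ℝ} {d : ℕ} (hd : 2 ≤ d) {φ : ℝ → ℝ}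
    (hφa : ∀ x, AnalyticAt ℝ φ x) (hφp : Function.Periodic φ 1) (hφnc : ∃ s t, φ s ≠ φ t)
    (hφb : ∀ θ, |φ θ| ≤ 1) (hβ : 0 < β)
    (hβmap : ∀ x ∈ Icc (-β) β, qm a x ∈ Ioo (-β) β) (hξ₀ : 0 < ξ₀)
    (hc : ∀ i, 2 * ξ₀ ≤ |(qm a)^[i + 1] 0|) (hs : Summable fun n => |critProd a n|⁻¹) {C : ℝ}
    (hC : ∀ N, ∑ n ∈ Finset.range (N + 1), |critProd a n| ≤ C * |critProd a N|) (M : ℕ) :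
    ∀ᶠ α in 𝓝[>] (0 : ℝ), ∃ G, IsExceptional a d φ α (Nal a ξ₀ α + M) G := by
  have hdR : (1 : ℝ) < d := by exact_mod_cast hd
  have hφ : Continuous φ := continuous_iff_continuousAt.2 fun x => (hφa x).continuousAt
  have hw : Summable fun n => |(critProd a n)⁻¹| := by simpa only [abs_inv] using hs
  set Φ := orbitSum d φ fun n => (critProd a n)⁻¹ with hΦ
  have hΦp : Function.Periodic Φ 1 := periodic_orbitSum d hφp _
  have hZfin : (⋃ i ∈ Finset.range M, {z | (qm a)^[i] z = 0}).Finite :=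
    (Finset.range M).finite_toSet.biUnion fun i _ => finite_iterate_eq_zero a i
  set Z := hZfin.toFinset with hZ
  obtain ⟨ε, hε, hεm⟩ := exists_measure_orbitSum_near_le hd hφa hφp hφnc hφb hw
    (by simp [critProd]) (κ := 2 / 3 / (Z.card + 1 : ℕ)) (by simp)
  set L := 216 * (∑' n, |critProd a n|⁻¹) * C / ξ₀ with hL
  obtain ⟨δ, hδ, hLδ⟩ : ∃ δ > 0, L * (2 * δ) ≤ ε / 4 := by
    refine ⟨ε / (8 * (|L| + 1)), by positivity, ?_⟩
    calc _ ≤ (|L| + 1) * (2 * (ε / (8 * (|L| + 1)))) := by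
          gcongr; linarith [le_abs_self L]
      _ = _ := by field_simp; norm_num
  obtain ⟨ρ, hρ, hρZ⟩ := exists_near_precritical a β M hδ
  obtain ⟨r, hr, hΦr⟩ := Metric.uniformContinuous_iff.1
    (hΦp.uniformContinuous (continuous_orbitSum d hφ hφb hw)) (ε / 4) (by positivity)
  obtain ⟨K, hK⟩ := ((tendsto_inv_pow_zero hd).eventually (gt_mem_nhds hr)).exists
  choose C' hC'0 hC' using exists_abs_fn_sub_iterate_le hβ.le d hφb hβmap
  have hCα : ∀ i ∈ Finset.range M, ∀ᶠ α in 𝓝[>] (0 : ℝ), C' i * α ≤ ρ / 2 := fun i _ => by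
    have : Tendsto (fun α => C' i * α) (𝓝[>] 0) (𝓝 (C' i * 0)) :=
      (tendsto_nhdsWithin_of_tendsto_nhds tendsto_id).const_mul _
    rw [mul_zero] at this
    exact this.eventually (eventually_le_nhds (half_pos hρ))
  filter_upwards [self_mem_nhdsWithin, eventually_traps hβ.le hβmap, eventually_le_Nal a hξ₀ K,
    (Finset.eventually_all (Finset.range M)).2 hCα,
    (tendsto_errSum hξ₀ hs).eventually (eventually_le_nhds (by positivity : 0 < ε / 8)),
    eventually_rpow_le (r := 0.6) (by norm_num) (half_pos hρ),
    eventually_rpow_le (r := 0.6) (by norm_num) hξ₀,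
    eventually_rpow_le (r := 0.6) (by norm_num) (half_pos hβ),
    eventually_rpow_le (r := 0.2) (κ := 1 / 4) (by norm_num) (by norm_num),
    eventually_rpow_le (r := 0.2) (κ := ε / 16) (by norm_num) (by positivity)]
    with α hα hB hNK hαρ herr h6ρ h6ξ h6β h2 h2ε
  have hα : 0 < α := hα
  have hcmp := inv_mul_critProd_Nal_le hξ₀ hα hc hs hC
  set N := Nal a ξ₀ α with hN
  set P : ℝ → ℝ → Prop := fun z τ => ∃ y, |y| ≤ 2 * α ^ (0.6 : ℝ) ∧
    |fn a d φ α (N + 1) τ y - z| ≤ δ with hP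
  refine ⟨{t | ∃ z ∈ Z, |Φ t - Φ (Classical.epsilon (P z))| ≤ ε}, fun t j => ?_, ?_, ?_⟩
  · simp only [mem_ofPred_eq, hΦp.add_natCast]
  · calc _ ≤ volume (⋃ z ∈ Z, {t | t ∈ Ico (0 : ℝ) 1 ∧ |Φ t - Φ (Classical.epsilon (P z))| ≤ ε}) :=
          measure_mono (by rintro t ⟨⟨z, hz, ht⟩, ht1⟩; exact mem_biUnion hz ⟨ht1, ht⟩)
      _ ≤ ∑ z ∈ Z, (2 / 3 / (Z.card + 1 : ℕ) : ℝ≥0∞) :=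
          (measure_biUnion_finset_le _ _).trans (Finset.sum_le_sum fun z _ => hεm _)
      _ ≤ (Z.card + 1 : ℕ) * (2 / 3 / (Z.card + 1 : ℕ) : ℝ≥0∞) := by
          rw [Finset.sum_const, nsmul_eq_mul]; gcongr; omega
      _ = 2 / 3 := ENNReal.mul_div_cancel (by simp) (by simp)
  · intro τ τ' y s hs1 hsT hy hret hττ'
    have hy2 : y ^ 2 ≤ α := (sq_le_four_mul_rpow hα hy).trans (by nlinarith)
    have hlt := Nal_lt_of_abs_fn_le hξ₀ hα hc hφb hy2 hs1 (hret.trans h6ξ)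
    obtain ⟨i, rfl⟩ := Nat.exists_eq_add_of_le' (Nat.succ_le_of_lt hlt)
    have hiM : i < M := by omega
    have huB := fn_mem_Icc (d := d) hB hφb (N + 1) τ
      (abs_le.1 (hy.trans (by linarith)) : y ∈ Icc (-β) β)
    have h1 := hC' i α hα hB ((d : ℝ) ^ (N + 1) * τ) _ huB _ huB
    rw [← fn_add, sub_self, abs_zero, zero_add, abs_sub_comm] at h1
    have h3 := hαρ i (Finset.mem_range.2 hiM)
    obtain ⟨z, hz0, hz⟩ := hρZ i hiM _ huB (by
      have := abs_sub_abs_le_abs_sub ((qm a)^[i] (fn a d φ α (N + 1) τ y))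
        (fn a d φ α (i + (N + 1)) τ y)
      have : |fn a d φ α (i + (N + 1)) τ y| ≤ α ^ (0.6 : ℝ) := hret
      linarith)
    refine ⟨z, hZfin.mem_toFinset.2 (mem_biUnion (Finset.mem_range.2 hiM) hz0), ?_⟩
    obtain ⟨y', hy', hz'⟩ := Classical.epsilon_spec (p := P z) ⟨τ, y, hy, hz.le⟩
    have h4 := abs_orbitSum_sub_le (d := d) (τ := τ) (τ' := Classical.epsilon (P z)) hξ₀ hα hc hs hφb
      (by linarith) hy hy'
    rw [← hΦ, ← hN] at h4
    have h5 : |fn a d φ α (N + 1) τ y - fn a d φ α (N + 1) (Classical.epsilon (P z)) y'|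
        ≤ 2 * δ := by
      have := abs_sub_le (fn a d φ α (N + 1) τ y) z
        (fn a d φ α (N + 1) (Classical.epsilon (P z)) y')
      rw [abs_sub_comm z] at this
      linarith
    have h7 := (mul_le_mul hcmp h5 (abs_nonneg _)
      ((by positivity : (0 : ℝ) ≤ 3 / (α * |critProd a N|)).trans hcmp)).trans hLδ
    have h8 : |Φ τ' - Φ τ| < ε / 4 := hΦr (by
      rw [Real.dist_eq, abs_sub_comm]
      refine lt_of_lt_of_le ?_ hK.le
      rw [← one_div, lt_div_iff₀ (by positivity)]
      refine lt_of_le_of_lt ?_ hττ'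
      gcongr
      · exact hdR.le
      · omega)
    have h9 := abs_sub_le (Φ τ') (Φ τ) (Φ (Classical.epsilon (P z)))
    linarith

theorem NkDef.lt_card {a : ℝ} {d : ℕ} {φ : ℝ → ℝ} {α : ℝ} {X : ℝ → ℝ} {θ : ℝ} {k : ℕ}
    (h : NkDef a d φ α X θ k) (hf : (Set.ofPred (IsRet a d φ α X θ)).Finite) :
    k < hf.toFinset.card := by
  rcases h with h | h
  · exact absurd hf h
  · rwa [← Set.ncard_eq_toFinset_card _ hf]

theorem Admissible.abs_fn_sub_fn_le {a β α : ℝ} {d n₀ : ℕ} {φ : ℝ → ℝ} (hd : 2 ≤ d)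
    (hα : 0 < α) (hB : Traps a β α) (hφp : Function.Periodic φ 1) (hφb : ∀ θ, |φ θ| ≤ 1)
    {K C R : ℝ} (hC : 0 < C)
    (hR : R ∈ Ioo (0 : ℝ) 2) (hK : 0 ≤ K) (hlip : ∀ x y, |φ x - φ y| ≤ K * |x - y|)
    (hder : ∀ θ, ∀ x ∈ Icc (-β) β, ∀ k, |deriv (fun y => fn a d φ α k θ y) x| ≤ C * R ^ k)
    {X : ℝ → ℝ} (hX : Admissible a d φ α β n₀ X) {n : ℕ} {θ θ' : ℝ} (hθ : θ ∈ Ico (0 : ℝ) 1)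
    (hθ' : θ' ∈ Ico (0 : ℝ) 1) (h : |θ - θ'| * (d : ℝ) ^ n ≤ 2) :
    |fn a d φ α n θ (X θ) - fn a d φ α n θ' (X θ')| ≤ 2 * K * C / (2 - R) * α := by
  obtain ⟨m, -, j, -, x₀, hx₀, hXeq⟩ := hX
  have hdm : (0 : ℝ) < (d : ℝ) ^ m := by positivity
  have key : ∀ t ∈ Ico (0 : ℝ) 1,
      fn a d φ α n t (X t) = fn a d φ α (n + m) ((t + j) / (d : ℝ) ^ m) x₀ := fun t ht => by
    rw [fn_add, hXeq t ht, mul_div_cancel₀ _ hdm.ne', fn_add_natCast a d hφp]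
  rw [key θ hθ, key θ' hθ']
  refine _root_.abs_fn_sub_fn_le hd hα hB hφb hC hR hK hlip hder hx₀ ?_
  rw [← sub_div, add_sub_add_right_eq_sub, abs_div, abs_of_pos hdm, pow_add, div_mul_eq_mul_div,
    mul_comm ((d : ℝ) ^ n), mul_left_comm, mul_div_cancel_left₀ _ hdm.ne']
  exact h

theorem volume_preimage_le_of_isExceptional {a α : ℝ} {d T : ℕ} {φ : ℝ → ℝ} (hd : 0 < d)
    {G : Set ℝ} (hG : IsExceptional a d φ α T G) (n j : ℕ) :
    volume {θ | θ ∈ Ico ((j : ℝ) / (d : ℝ) ^ n) ((j + 1) / (d : ℝ) ^ n) ∧ (d : ℝ) ^ n * θ ∈ G} ≤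
      2 / 3 * volume (Ico ((j : ℝ) / (d : ℝ) ^ n) ((j + 1) / (d : ℝ) ^ n)) := by
  have hdn : (0 : ℝ) < (d : ℝ) ^ n := by positivity
  calc _ ≤ volume ((fun θ => (d : ℝ) ^ n * θ) ⁻¹' ((fun x => x - (j : ℝ)) ⁻¹' (G ∩ Ico 0 1))) := by
        refine measure_mono ?_
        rintro θ ⟨⟨h1, h2⟩, hθ⟩
        rw [div_le_iff₀' hdn] at h1
        rw [lt_div_iff₀' hdn] at h2
        refine ⟨?_, ?_, ?_⟩
        · rw [← hG.1 _ j]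
          simpa using hθ
        · simpa using h1
        · simpa [sub_lt_iff_lt_add'] using h2
    _ = ENNReal.ofReal ((d : ℝ) ^ n)⁻¹ * volume (G ∩ Ico 0 1) := by
        simp only [sub_eq_add_neg]
        rw [Real.volume_preimage_mul_left hdn.ne', measure_preimage_add_right,
          abs_of_pos (inv_pos.2 hdn)]
    _ ≤ ENNReal.ofReal ((d : ℝ) ^ n)⁻¹ * (2 / 3) := by gcongr; exact hG.2.1
    _ = _ := by
        rw [Real.volume_Ico, ← sub_div, add_sub_cancel_left, one_div, mul_comm]

/-- Given `M > 0`, for `α > 0` small enough the following holds. Let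
`X : [0,1) → B_α` be an admissible curve with return times `n_k`. For each `n ≥ 0`, `k ≥ 0`,
if `ω = [j/dⁿ, (j+1)/dⁿ) ∈ 𝒫_n` is an element on which `n_k ≡ n`, then
`|{θ ∈ ω : n_{k+1}(θ) - n_k(θ) ≤ N(α) + M}| ≤ (2/3)|ω|`. -/
theorem return_time_gap_bound
    (a : ℝ) (ha : a ∈ Set.Ioo (1 : ℝ) 2) (hpre : StrictlyPreperiodic a)
    (d : ℕ) (hd : 2 ≤ d)
    (φ : ℝ → ℝ) (hφa : ∀ x : ℝ, AnalyticAt ℝ φ x) (hφp : Function.Periodic φ 1)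
    (hφnc : ∃ s t : ℝ, φ s ≠ φ t) (hφb : ∀ θ : ℝ, |φ θ| ≤ 1)
    (β : ℝ) (hβ1 : 1 < β) (hβ2 : β < |(-1 - Real.sqrt (1 + 4 * a)) / 2|)
    (hβmap : ∀ x ∈ Set.Icc (-β) β, qm a x ∈ Set.Ioo (-β) β)
    (hβder : ∀ x : ℝ, β ≤ |x| → 2 * β ≤ |deriv (qm a) x|)
    (n₀ : ℕ)
    (hdom : ∃ C₁ R₁ : ℝ, 0 < C₁ ∧ R₁ ∈ Set.Ioo (0 : ℝ) 2 ∧ ∃ α₁ > 0, ∀ α : ℝ, 0 < α → α < α₁ →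
      ∀ θ x : ℝ, x ∈ Set.Icc (-β) β → ∀ k : ℕ,
        |deriv (fun y => fn a d φ α k θ y) x| ≤ C₁ * R₁ ^ k ∧
        (n₀ ≤ k → |deriv (fun y => fn a d φ α k θ y) x| ≤ R₁ ^ k ∧ R₁ ^ k ≤ (d : ℝ) ^ k / 6))
    (ξ₀ : ℝ) (hξ₀ : 0 < ξ₀)
    (hcrit : ∀ i : ℕ, 1 ≤ i → (qm a)^[i] 0 ∉ Set.Ioo (-(2 * ξ₀)) (2 * ξ₀))
    :
    ∀ M : ℕ, 0 < M → ∃ α₀ > 0, ∀ α : ℝ, 0 < α → α < α₀ → α ≤ ξ₀ →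
      ∀ X : ℝ → ℝ, Admissible a d φ α β n₀ X →
        Set.MapsTo X (Set.Ico (0 : ℝ) 1)
          (Set.Icc (-(2 * α ^ (0.6 : ℝ))) (2 * α ^ (0.6 : ℝ))) →
        ∀ n k j : ℕ, j < d ^ n →
          (∀ θ ∈ Set.Ico ((j : ℝ) / (d : ℝ) ^ n) (((j : ℝ) + 1) / (d : ℝ) ^ n),
            NkDef a d φ α X θ k ∧ nk a d φ α X θ k = n) →
          volume {θ : ℝ | θ ∈ Set.Ico ((j : ℝ) / (d : ℝ) ^ n) (((j : ℝ) + 1) / (d : ℝ) ^ n) ∧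
              NkDef a d φ α X θ (k + 1) ∧
              nk a d φ α X θ (k + 1) - nk a d φ α X θ k ≤ Nal a ξ₀ α + M} ≤
            (2 / 3 : ℝ≥0∞) *
              volume (Set.Ico ((j : ℝ) / (d : ℝ) ^ n) (((j : ℝ) + 1) / (d : ℝ) ^ n)) := by
  intro M _
  have hd0 : (0 : ℝ) < d := by positivity
  have hβ : 0 < β := one_pos.trans hβ1
  have hc : ∀ i, 2 * ξ₀ ≤ |(qm a)^[i + 1] 0| := fun i => by
    by_contra! h
    exact hcrit (i + 1) (by omega) (abs_lt.1 h)
  obtain ⟨-, m, p, -, hp, hmp⟩ := hpre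
  have hcore : ∀ᶠ α in 𝓝[>] (0 : ℝ), ∃ G, IsExceptional a d φ α (Nal a ξ₀ α + M) G := by
    rcases critProd_dichotomy hξ₀ hc hp hmp with ⟨C, hC⟩ | ⟨hs, C, hC⟩
    · exact (eventually_isExceptional_empty hβ hβmap hφb hξ₀ hc hC M).mono fun α h => ⟨_, h⟩
    · exact eventually_exists_isExceptional hd hφa hφp hφnc hφb hβ hβmap hξ₀ hc hs hC M
  obtain ⟨K, hK, hlip⟩ := exists_lipschitz_of_periodic hφa hφp
  obtain ⟨C, R, hC, hR, α₁, hα₁, hder⟩ := hdom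
  have hosc : ∀ᶠ α in 𝓝[>] (0 : ℝ), 2 * K * C / (2 - R) * α ≤ α ^ (0.6 : ℝ) := by
    have hR2 : 0 < 2 - R := sub_pos.2 hR.2
    filter_upwards [self_mem_nhdsWithin, eventually_rpow_le (r := 0.4)
      (κ := (2 * K * C / (2 - R) + 1)⁻¹) (by norm_num) (by positivity)] with α hα h
    have hα : 0 < α := hα
    have e : α = α ^ (0.4 : ℝ) * α ^ (0.6 : ℝ) := by
      rw [← Real.rpow_add hα]; norm_num
    have h1 : (2 * K * C / (2 - R) + 1) * α ^ (0.4 : ℝ) ≤ 1 := by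
      rwa [← le_div_iff₀' (by positivity), one_div]
    calc 2 * K * C / (2 - R) * α
        ≤ (2 * K * C / (2 - R) + 1) * α := by gcongr; linarith
      _ = (2 * K * C / (2 - R) + 1) * α ^ (0.4 : ℝ) * α ^ (0.6 : ℝ) := by
        rw [mul_assoc (2 * K * C / (2 - R) + 1), ← e]
      _ ≤ _ := mul_le_of_le_one_left (by positivity) h1
  obtain ⟨α₀, hα₀, hsub⟩ := mem_nhdsGT_iff_exists_Ioo_subset.1
    (hcore.and (hosc.and ((eventually_traps hβ.le hβmap).and (Ioo_mem_nhdsGT hα₁))))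
  refine ⟨α₀, hα₀, fun α hα hαα₀ _ X hX hXm n k j hj hω => ?_⟩
  obtain ⟨⟨G, hG⟩, hosc, hB, -, hα1⟩ := hsub ⟨hα, hαα₀⟩
  refine (measure_mono ?_).trans (volume_preimage_le_of_isExceptional (by omega) hG n j)
  rintro θ ⟨hθ, hdef, hgap⟩
  refine ⟨hθ, ?_⟩
  obtain ⟨hk, hkn⟩ := hω θ hθ
  have hmem := Nat.nth_mem _ hdef.lt_card
  have hlt := Nat.nth_lt_nth' k.lt_succ_self hdef.lt_card
  have hn := Nat.nth_mem _ hk.lt_card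
  change IsRet a d φ α X θ (nk a d φ α X θ (k + 1)) at hmem
  change nk a d φ α X θ k < nk a d φ α X θ (k + 1) at hlt
  change IsRet a d φ α X θ (nk a d φ α X θ k) at hn
  rw [hkn] at hgap hlt hn
  obtain ⟨s, hs⟩ := Nat.exists_eq_add_of_le hlt.le
  rw [hs] at hgap hlt hmem
  rcases hmem with h0 | ⟨-, σ, hσ, hfloor, hret⟩
  · omega
  have hσθ : |σ - θ| * (d : ℝ) ^ (n + s) < 1 := by
    have := Int.abs_sub_lt_one_of_floor_eq_floor hfloor
    rwa [← sub_mul, abs_mul, abs_of_pos (by positivity : (0 : ℝ) < (d : ℝ) ^ (n + s))] at this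
  have hy : |fn a d φ α n σ (X σ)| ≤ 2 * α ^ (0.6 : ℝ) := by
    rcases hn with rfl | ⟨-, σ', hσ', hfloor', hret'⟩
    · exact abs_le.2 (hXm hσ)
    · have h1 : |σ' - θ| * (d : ℝ) ^ n < 1 := by
        have := Int.abs_sub_lt_one_of_floor_eq_floor hfloor'
        rwa [← sub_mul, abs_mul, abs_of_pos (by positivity : (0 : ℝ) < (d : ℝ) ^ n)] at this
      have h2 : |σ - θ| * (d : ℝ) ^ n < 1 := by
        refine lt_of_le_of_lt ?_ hσθ
        gcongr
        exact_mod_cast (by omega : 1 ≤ d)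
      have h3 : |σ - σ'| * (d : ℝ) ^ n ≤ 2 := by
        have := abs_sub_le σ θ σ'
        rw [abs_sub_comm θ] at this
        nlinarith [pow_pos hd0 n]
      have h4 := hX.abs_fn_sub_fn_le hd hα hB hφp hφb hC hR hK hlip
        (fun θ x hx k => (hder α hα hα1 θ x hx k).1) hσ hσ' h3
      linarith [abs_sub_abs_le_abs_sub (fn a d φ α n σ (X σ)) (fn a d φ α n σ' (X σ'))]
  rw [add_comm n s, fn_add] at hret
  refine hG.2.2 _ _ _ s (by omega) (by omega) hy hret ?_
  rwa [← mul_sub, abs_mul, abs_of_pos (by positivity : (0 : ℝ) < (d : ℝ) ^ n), mul_right_comm,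
    ← pow_add, mul_comm]
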